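/- arXiv:2106.08635 — 4 statements merged into one kernel-verified Lean document; each statement's English description precedes it below -/
import Mathlib

section
/- Let S and S~ be smooth functions on (open subsets of) ℝ²×ℝ² whose zero sets define nonholonomic constraint submanifolds (i.e. the gradient of S with respect to the velocity variable ẋ is nonzero at every point of {S=0}, and likewise for S~). Let F(x,w) and F~(x~,w~) be regular parametrisations (first extensions) of these submanifolds. Then the following are locally equivalent (around corresponding points): (i) the submanifolds {S=0} and {S~=0} are equivalent via a local diffeomorphism φ of ℝ² and a smooth nonvanishing function δ(x,ẋ), i.e. S~(φ(x),Dφ(x)ẋ) = δ(x,ẋ)·S(x,ẋ); (ii) the systems ẋ=F(x,w) and ẋ~=F~(x~,w~) are feedback equivalent via φ and a reparametrisation w~=ψ(x,w); (iii) the second extensions (ẋ=F(x,w), ẇ=u) and (ẋ~=F~(x~,w~), ẇ~=ũ) are feedback equivalent as control-affine systems on ℝ³ via the diffeomorphism (x,w)↦(φ(x),ψ(x,w)) and a control-affine feedback ũ=α(x,w)+β(x,w)u with β nonvanishing. -/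
noncomputable section

open Set

/-- (i): the constraint submanifolds `{S = 0}` and `{S' = 0}` are locally equivalent around
`(x₀, F x₀ w₀)` and `(x₀', F' x₀' w₀')` via a local diffeomorphism `φ` of `ℝ²` and a smooth
nonvanishing function `δ(x, ẋ)`, i.e. `S'(φ x, Dφ(x) ẋ) = δ(x, ẋ) · S(x, ẋ)`. -/
def SubmanifoldsEquiv (S S' : (ℝ × ℝ) → (ℝ × ℝ) → ℝ)
    (F F' : (ℝ × ℝ) → ℝ → (ℝ × ℝ)) (x₀ x₀' : ℝ × ℝ) (w₀ w₀' : ℝ) : Prop :=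
  ∃ (φ : (ℝ × ℝ) → (ℝ × ℝ)) (δ : (ℝ × ℝ) → (ℝ × ℝ) → ℝ) (U V : Set (ℝ × ℝ)),
    IsOpen U ∧ x₀ ∈ U ∧ IsOpen V ∧ F x₀ w₀ ∈ V ∧
    ContDiffOn ℝ (⊤ : ℕ∞) φ U ∧ (∀ x ∈ U, Function.Bijective (fderiv ℝ φ x)) ∧
    φ x₀ = x₀' ∧ fderiv ℝ φ x₀ (F x₀ w₀) = F' x₀' w₀' ∧
    ContDiffOn ℝ (⊤ : ℕ∞) (fun p : (ℝ × ℝ) × (ℝ × ℝ) => δ p.1 p.2) (U ×ˢ V) ∧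
    (∀ x ∈ U, ∀ v ∈ V, δ x v ≠ 0) ∧
    (∀ x ∈ U, ∀ v ∈ V, S' (φ x) (fderiv ℝ φ x v) = δ x v * S x v)

/-- (ii): the first extensions `ẋ = F(x,w)` and `ẋ' = F'(x',w')` are locally feedback
equivalent around `(x₀, w₀)` and `(x₀', w₀')` via `x' = φ(x)` and `w' = ψ(x,w)`. -/
def FirstExtensionsEquiv (F F' : (ℝ × ℝ) → ℝ → (ℝ × ℝ))
    (x₀ x₀' : ℝ × ℝ) (w₀ w₀' : ℝ) : Prop :=
  ∃ (φ : (ℝ × ℝ) → (ℝ × ℝ)) (ψ : (ℝ × ℝ) → ℝ → ℝ) (U : Set (ℝ × ℝ)) (W : Set ℝ),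
    IsOpen U ∧ x₀ ∈ U ∧ IsOpen W ∧ w₀ ∈ W ∧
    ContDiffOn ℝ (⊤ : ℕ∞) φ U ∧ (∀ x ∈ U, Function.Bijective (fderiv ℝ φ x)) ∧ φ x₀ = x₀' ∧
    ContDiffOn ℝ (⊤ : ℕ∞) (fun p : (ℝ × ℝ) × ℝ => ψ p.1 p.2) (U ×ˢ W) ∧ ψ x₀ w₀ = w₀' ∧
    (∀ x ∈ U, ∀ w ∈ W, Function.Bijective
      (fderiv ℝ (fun p : (ℝ × ℝ) × ℝ => ((φ p.1, ψ p.1 p.2) : (ℝ × ℝ) × ℝ)) (x, w))) ∧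
    (∀ x ∈ U, ∀ w ∈ W, fderiv ℝ φ x (F x w) = F' (φ x) (ψ x w))

/-- (iii): the second extensions `(ẋ = F(x,w), ẇ = u)` and `(ẋ' = F'(x',w'), ẇ' = u')`,
viewed as control-affine systems on `ℝ³ = ℝ² × ℝ` with drifts `f(x,w) = (F(x,w), 0)` and
control vector fields `g = (0,0,1)`, are locally feedback equivalent via the diffeomorphism
`(x,w) ↦ (φ(x), ψ(x,w))` and the control-affine feedback `u' = α(x,w) + β(x,w) u`,
`β` nonvanishing; i.e. `Φ∗(f + α g) = f'` and `Φ∗(β g) = g'`. -/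
def SecondExtensionsEquiv (F F' : (ℝ × ℝ) → ℝ → (ℝ × ℝ))
    (x₀ x₀' : ℝ × ℝ) (w₀ w₀' : ℝ) : Prop :=
  ∃ (φ : (ℝ × ℝ) → (ℝ × ℝ)) (ψ : (ℝ × ℝ) → ℝ → ℝ)
    (α β : (ℝ × ℝ) × ℝ → ℝ) (U : Set (ℝ × ℝ)) (W : Set ℝ),
    IsOpen U ∧ x₀ ∈ U ∧ IsOpen W ∧ w₀ ∈ W ∧
    ContDiffOn ℝ (⊤ : ℕ∞) φ U ∧ φ x₀ = x₀' ∧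
    ContDiffOn ℝ (⊤ : ℕ∞) (fun p : (ℝ × ℝ) × ℝ => ψ p.1 p.2) (U ×ˢ W) ∧ ψ x₀ w₀ = w₀' ∧
    ContDiffOn ℝ (⊤ : ℕ∞) α (U ×ˢ W) ∧ ContDiffOn ℝ (⊤ : ℕ∞) β (U ×ˢ W) ∧
    (∀ p ∈ U ×ˢ W, β p ≠ 0) ∧
    (∀ p ∈ U ×ˢ W, Function.Bijective
      (fderiv ℝ (fun q : (ℝ × ℝ) × ℝ => ((φ q.1, ψ q.1 q.2) : (ℝ × ℝ) × ℝ)) p)) ∧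
    (∀ p ∈ U ×ˢ W,
      fderiv ℝ (fun q : (ℝ × ℝ) × ℝ => ((φ q.1, ψ q.1 q.2) : (ℝ × ℝ) × ℝ)) p
          (((F p.1 p.2, (0 : ℝ)) : (ℝ × ℝ) × ℝ) + α p • (((0 : ℝ × ℝ), (1 : ℝ)) : (ℝ × ℝ) × ℝ))
        = ((F' (φ p.1) (ψ p.1 p.2), (0 : ℝ)) : (ℝ × ℝ) × ℝ) ∧
      fderiv ℝ (fun q : (ℝ × ℝ) × ℝ => ((φ q.1, ψ q.1 q.2) : (ℝ × ℝ) × ℝ)) p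
          (β p • (((0 : ℝ × ℝ), (1 : ℝ)) : (ℝ × ℝ) × ℝ))
        = (((0 : ℝ × ℝ), (1 : ℝ)) : (ℝ × ℝ) × ℝ))

section Aux
open Filter Topology MeasureTheory

/-- smooth in a neighbourhood of a point -/
def SmNear {E F : Type*} [NormedAddCommGroup E] [NormedSpace ℝ E] [NormedAddCommGroup F]
    [NormedSpace ℝ F] (f : E → F) (p : E) : Prop := ∀ᶠ q in 𝓝 p, ContDiffAt ℝ (⊤ : ℕ∞) f q

lemma hadamard_aux {E : Type*} [NormedAddCommGroup E] [NormedSpace ℝ E]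
    (h : E × ℝ → ℝ) (p₀ : E) (r : ℝ) (hr : 0 < r)
    (hh : ∀ p ∈ Metric.ball p₀ r, ∀ s ∈ Metric.ball (0 : ℝ) r, ContDiffAt ℝ (⊤ : ℕ∞) h (p, s)) :
    ContDiffOn ℝ (⊤ : ℕ∞) (fun q : E × ℝ => ∫ t in (0:ℝ)..1, h (q.1, t * q.2))
      (Metric.ball p₀ r ×ˢ Metric.ball (0 : ℝ) (r / 3)) := by
  let χ : ContDiffBump (0 : ℝ) := ⟨1, 2, by norm_num, by norm_num⟩
  let g : E × ℝ → ℝ → ℝ := fun q y => χ y * h (q.1, (-y) * q.2)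
  have key := contDiffOn_convolution_right_with_param_comp (𝕜 := ℝ) (μ := volume) (n := (⊤ : ℕ∞))
    (ContinuousLinearMap.mul ℝ ℝ)
    (s := Metric.ball p₀ r ×ˢ Metric.ball (0 : ℝ) (r / 3)) (v := fun _ : E × ℝ => (0:ℝ))
    contDiffOn_const (f := (Ioc (0:ℝ) 1).indicator (fun _ => (1:ℝ))) (g := g)
    (k := Metric.closedBall 0 2)
    (Metric.isOpen_ball.prod Metric.isOpen_ball) (isCompact_closedBall _ _) ?_ ?_ ?_
  · refine key.congr ?_
    intro q hq
    rw [convolution, intervalIntegral.integral_of_le zero_le_one, ← integral_indicator measurableSet_Ioc]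
    congr 1
    ext t
    by_cases ht : t ∈ Ioc (0:ℝ) 1
    · have h1 : χ (0 - t) = 1 := by
        apply χ.one_of_mem_closedBall
        simp only [χ, Metric.mem_closedBall, Real.dist_eq]
        rw [abs_le]; constructor <;> linarith [ht.1, ht.2]
      simp only [Set.indicator_of_mem ht, g, ContinuousLinearMap.mul_apply', h1]
      simp
    · simp [Set.indicator_of_notMem ht]
  · intro p x _ hx
    have : χ x = 0 := by
      apply χ.zero_of_le_dist
      simp only [χ, Metric.mem_closedBall, not_le] at hx ⊢
      exact hx.le
    simp [g, this]
  · apply Integrable.locallyIntegrable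
    rw [integrable_indicator_iff measurableSet_Ioc]
    exact integrableOn_const (by simp)
  · rintro ⟨⟨p, s⟩, y⟩ ⟨⟨hp, hs⟩, -⟩
    apply ContDiffAt.contDiffWithinAt
    simp only [Metric.mem_ball, dist_zero_right, Real.norm_eq_abs] at hp hs
    rcases lt_or_ge |y| 3 with hy | hy
    · have h1 : ContDiffAt ℝ (⊤ : ℕ∞) h (p, (-y) * s) := by
        apply hh p (by simpa using hp)
        simp only [Metric.mem_ball, dist_zero_right, Real.norm_eq_abs, abs_mul, abs_neg]
        have := abs_nonneg y
        have := abs_nonneg s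
        nlinarith
      have h2 : ContDiffAt ℝ (⊤ : ℕ∞) (fun q : (E × ℝ) × ℝ => h (q.1.1, (-q.2) * q.1.2)) ((p, s), y) :=
        ContDiffAt.comp ((p, s), y) (g := h) (f := fun q : (E × ℝ) × ℝ => (q.1.1, (-q.2) * q.1.2)) h1 (by fun_prop)
      have h3 : ContDiffAt ℝ (⊤ : ℕ∞) (fun q : (E × ℝ) × ℝ => χ q.2) ((p, s), y) :=
        (χ.contDiff (n := (⊤ : ℕ∞))).contDiffAt.comp _ contDiffAt_snd
      exact h3.mul h2
    · have : (fun _ => (0:ℝ)) =ᶠ[𝓝 ((p, s), y)] Function.HasUncurry.uncurry g := by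
        have : ∀ᶠ q : (E × ℝ) × ℝ in 𝓝 ((p, s), y), 2 < |q.2| := by
          apply (by fun_prop : Continuous (fun q : (E × ℝ) × ℝ => |q.2|)).continuousAt.eventually (lt_mem_nhds (by simp; linarith))
        filter_upwards [this] with q hq
        have : χ q.2 = 0 := by
          apply χ.zero_of_le_dist
          simp only [χ, dist_zero_right, Real.norm_eq_abs]
          exact hq.le
        simp [Function.HasUncurry.uncurry, g, this]
      exact contDiffAt_const.congr_of_eventuallyEq this.symm

lemma hadamard {E : Type*} [NormedAddCommGroup E] [NormedSpace ℝ E]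
    (f : E × ℝ → ℝ) (p₀ : E) (hf : SmNear f (p₀, 0)) (h0 : ∀ᶠ p in 𝓝 p₀, f (p, 0) = 0) :
    ∃ a : E × ℝ → ℝ, SmNear a (p₀, 0) ∧ (∀ᶠ q in 𝓝 (p₀, (0:ℝ)), f q = q.2 * a q) ∧
      a (p₀, 0) = fderiv ℝ f (p₀, 0) (0, 1) := by
  obtain ⟨r, hr, hr1⟩ := Metric.eventually_nhds_iff_ball.1 hf
  obtain ⟨r2, hr2, hr3⟩ := Metric.eventually_nhds_iff_ball.1 h0
  set R := min r r2
  have hR : 0 < R := lt_min hr hr2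
  have hsm : ∀ p ∈ Metric.ball p₀ R, ∀ s ∈ Metric.ball (0 : ℝ) R, ContDiffAt ℝ (⊤ : ℕ∞) f (p, s) := by
    intro p hp s hs
    apply hr1
    rw [← ball_prod_same]
    exact ⟨Metric.ball_subset_ball (min_le_left _ _) hp, Metric.ball_subset_ball (min_le_left _ _) hs⟩
  let h : E × ℝ → ℝ := fun q => fderiv ℝ f q (0, 1)
  have hh : ∀ p ∈ Metric.ball p₀ R, ∀ s ∈ Metric.ball (0 : ℝ) R, ContDiffAt ℝ (⊤ : ℕ∞) h (p, s) := by
    intro p hp s hs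
    exact ((hsm p hp s hs).fderiv_right (m := (⊤ : ℕ∞)) (by simp)).clm_apply contDiffAt_const
  have hopen : IsOpen (Metric.ball p₀ R ×ˢ Metric.ball (0 : ℝ) (R / 3)) :=
    Metric.isOpen_ball.prod Metric.isOpen_ball
  have hmem : (p₀, (0:ℝ)) ∈ (Metric.ball p₀ R ×ˢ Metric.ball (0 : ℝ) (R / 3)) := by
    constructor <;> simp <;> positivity
  refine ⟨fun q : E × ℝ => ∫ t in (0:ℝ)..1, h (q.1, t * q.2), ?_, ?_, ?_⟩
  · filter_upwards [hopen.mem_nhds hmem] with q hq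
    exact (hadamard_aux h p₀ R hR hh).contDiffAt (hopen.mem_nhds hq)
  · filter_upwards [hopen.mem_nhds hmem] with q hq
    obtain ⟨p, s⟩ := q
    obtain ⟨hp, hs⟩ := hq
    simp only [Metric.mem_ball, dist_zero_right, Real.norm_eq_abs] at hp hs
    have hin : ∀ t ∈ uIcc (0:ℝ) 1, t * s ∈ Metric.ball (0:ℝ) R := by
      intro t ht
      rw [uIcc_of_le zero_le_one] at ht
      simp only [Metric.mem_ball, dist_zero_right, Real.norm_eq_abs, abs_mul, abs_of_nonneg ht.1]
      have := abs_nonneg s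
      nlinarith [ht.1, ht.2]
    have ftc := intervalIntegral.integral_eq_sub_of_hasDerivAt (a := 0) (b := 1)
      (f := fun t : ℝ => f (p, t * s)) (f' := fun t => s * h (p, t * s)) ?_ ?_
    · rw [intervalIntegral.integral_const_mul] at ftc
      simp only [one_mul, zero_mul] at ftc
      rw [hr3 p (Metric.ball_subset_ball (min_le_right _ _) hp)] at ftc
      simp only [ftc, sub_zero]
    · intro t ht
      have h1 := ((hsm p hp _ (hin t ht)).differentiableAt (by simp)).hasFDerivAt
      have h2 : HasDerivAt (fun t : ℝ => (p, t * s)) ((0 : E), s) t :=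
        (hasDerivAt_const t p).prodMk (by simpa using (hasDerivAt_id t).mul_const s)
      have h3 := h1.comp_hasDerivAt t h2
      have h4 : ((0:E), s) = s • ((0:E), (1:ℝ)) := by simp
      rw [h4, map_smul] at h3
      exact h3
    · apply ContinuousOn.intervalIntegrable
      intro t ht
      have := (hh p hp _ (hin t ht)).continuousAt
      apply ContinuousAt.continuousWithinAt
      apply ContinuousAt.mul continuousAt_const
      exact ContinuousAt.comp (g := h) (f := fun t : ℝ => (p, t * s)) this (by fun_prop)
  · simp [h]

section api
variable {E F G : Type*} [NormedAddCommGroup E] [NormedSpace ℝ E] [NormedAddCommGroup F]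
    [NormedSpace ℝ F] [NormedAddCommGroup G] [NormedSpace ℝ G]

lemma SmNear.continuousAt {f : E → F} {p : E} (hf : SmNear f p) : ContinuousAt f p :=
  ContDiffAt.continuousAt (Eventually.self_of_nhds hf)

lemma SmNear.comp {g : F → G} {f : E → F} {p : E} (hg : SmNear g (f p)) (hf : SmNear f p) :
    SmNear (fun x => g (f x)) p := by
  have h1 := hf.continuousAt.eventually hg
  filter_upwards [h1, (show ∀ᶠ q in 𝓝 p, ContDiffAt ℝ (⊤ : ℕ∞) f q from hf)] with q h2 h3
  exact ContDiffAt.comp q h2 h3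

lemma SmNear.prodMk {g : E → G} {f : E → F} {p : E} (hg : SmNear g p) (hf : SmNear f p) :
    SmNear (fun x => (g x, f x)) p := by
  filter_upwards [(show ∀ᶠ q in 𝓝 p, ContDiffAt ℝ (⊤ : ℕ∞) g q from hg),
    (show ∀ᶠ q in 𝓝 p, ContDiffAt ℝ (⊤ : ℕ∞) f q from hf)] with q h2 h3
  exact h2.prodMk h3

lemma SmNear.clm_apply {g : E → F →L[ℝ] G} {f : E → F} {p : E} (hg : SmNear g p) (hf : SmNear f p) :
    SmNear (fun x => g x (f x)) p := by
  filter_upwards [(show ∀ᶠ q in 𝓝 p, ContDiffAt ℝ (⊤ : ℕ∞) g q from hg),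
    (show ∀ᶠ q in 𝓝 p, ContDiffAt ℝ (⊤ : ℕ∞) f q from hf)] with q h2 h3
  exact h2.clm_apply h3

lemma SmNear.fderiv {f : E → F} {p : E} (hf : SmNear f p) : SmNear (fderiv ℝ f) p := by
  filter_upwards [(show ∀ᶠ q in 𝓝 p, ContDiffAt ℝ (⊤ : ℕ∞) f q from hf)] with q h3
  exact h3.fderiv_right (by simp)

lemma SmNear.div {f g : E → ℝ} {p : E} (hf : SmNear f p) (hg : SmNear g p) (h : g p ≠ 0) :
    SmNear (fun x => f x / g x) p := by
  filter_upwards [(show ∀ᶠ q in 𝓝 p, ContDiffAt ℝ (⊤ : ℕ∞) g q from hg),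
    (show ∀ᶠ q in 𝓝 p, ContDiffAt ℝ (⊤ : ℕ∞) f q from hf),
    hg.continuousAt.eventually_ne h] with q h2 h3 h4
  exact h3.div h2 h4

lemma smNear_of_contDiff {f : E → F} (hf : ContDiff ℝ (⊤ : ℕ∞) f) (p : E) : SmNear f p :=
  Eventually.of_forall fun _ => hf.contDiffAt

lemma smNear_of_contDiffOn {f : E → F} {U : Set E} (hf : ContDiffOn ℝ (⊤ : ℕ∞) f U)
    (hU : IsOpen U) {p : E} (hp : p ∈ U) : SmNear f p := by
  filter_upwards [hU.mem_nhds hp] with q hq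
  exact hf.contDiffAt (hU.mem_nhds hq)

lemma inverse_near [CompleteSpace E] {f : E → F} (hf : ContDiff ℝ (⊤ : ℕ∞) f) (a : E)
    (f' : E ≃L[ℝ] F) (hf' : fderiv ℝ f a = f') :
    ∃ i : F → E, SmNear i (f a) ∧ i (f a) = a ∧ ∀ᶠ y in 𝓝 (f a), f (i y) = y := by
  have hn : ((⊤ : ℕ∞) : WithTop ℕ∞) ≠ 0 := by simp
  have hd : HasFDerivAt f (f' : E →L[ℝ] F) a := by
    rw [← hf']; exact (hf.differentiable hn a).hasFDerivAt
  let e := hf.contDiffAt.toOpenPartialHomeomorph f hd hn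
  have ha : a ∈ e.source := hf.contDiffAt.mem_toOpenPartialHomeomorph_source hd hn
  have hfa : f a ∈ e.target := hf.contDiffAt.image_mem_toOpenPartialHomeomorph_target hd hn
  have hia : e.symm (f a) = a := e.left_inv ha
  have hc : ContinuousAt e.symm (f a) := e.continuousAt_symm hfa
  refine ⟨e.symm, ?_, hia, ?_⟩
  · have h1 : ∀ᶠ p in 𝓝 a, fderiv ℝ f p ∈ range ((↑) : (E ≃L[ℝ] F) → E →L[ℝ] F) := by
      apply (hf.continuous_fderiv hn).continuousAt.eventually
      rw [hf']; exact ContinuousLinearEquiv.nhds f'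
    rw [← hia] at h1
    filter_upwards [hc.eventually h1, e.open_target.mem_nhds hfa] with y hy hy2
    obtain ⟨A, hA⟩ := hy
    apply e.contDiffAt_symm hy2 (f₀' := A) _ hf.contDiffAt
    rw [hA]; exact (hf.differentiable hn _).hasFDerivAt
  · filter_upwards [e.open_target.mem_nhds hfa] with y hy2
    exact e.right_inv hy2

lemma fderiv_uncurry {f : E → ℝ → G} {x : E} {w : ℝ}
    (hf : DifferentiableAt ℝ (fun p : E × ℝ => f p.1 p.2) (x, w)) :
    HasDerivAt (f x) (fderiv ℝ (fun p : E × ℝ => f p.1 p.2) (x, w) (0, 1)) w := by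
  have h2 : HasDerivAt (fun t : ℝ => (x, t)) ((0 : E), (1:ℝ)) w :=
    (hasDerivAt_const w x).prodMk (hasDerivAt_id w)
  exact hf.hasFDerivAt.comp_hasDerivAt w h2

lemma line_deriv {g : F → G} (L : E →L[ℝ] F) (v n : E) (hg : DifferentiableAt ℝ g (L v)) :
    HasDerivAt (fun s : ℝ => g (L (v + s • n))) (fderiv ℝ g (L v) (L n)) 0 := by
  have h2 : HasDerivAt (fun s : ℝ => L (v + s • n)) (L n) 0 := by
    apply L.hasFDerivAt.comp_hasDerivAt
    simpa using ((hasDerivAt_id (0:ℝ)).smul_const n).const_add v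
  have h3 : DifferentiableAt ℝ g (L (v + (0:ℝ) • n)) := by simpa using hg
  simpa [Function.comp_def] using h3.hasFDerivAt.comp_hasDerivAt (0:ℝ) h2

end api

lemma blk_apply {φ : ℝ × ℝ → ℝ × ℝ} {ψ : ℝ × ℝ → ℝ → ℝ} {x : ℝ × ℝ} {w : ℝ}
    (hφ : DifferentiableAt ℝ φ x)
    (hψ : DifferentiableAt ℝ (fun p : (ℝ × ℝ) × ℝ => ψ p.1 p.2) (x, w)) (q : (ℝ × ℝ) × ℝ) :
    fderiv ℝ (fun p : (ℝ × ℝ) × ℝ => ((φ p.1, ψ p.1 p.2) : (ℝ × ℝ) × ℝ)) (x, w) q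
      = (fderiv ℝ φ x q.1, fderiv ℝ (fun p : (ℝ × ℝ) × ℝ => ψ p.1 p.2) (x, w) q) := by
  have h1 : HasFDerivAt (fun p : (ℝ × ℝ) × ℝ => φ p.1)
      ((fderiv ℝ φ x).comp (ContinuousLinearMap.fst ℝ (ℝ × ℝ) ℝ)) (x, w) :=
    HasFDerivAt.comp (x, w) (g := φ) (f := Prod.fst) hφ.hasFDerivAt hasFDerivAt_fst
  rw [(h1.prodMk hψ.hasFDerivAt).fderiv]
  rfl

lemma bij_iff_inj {E : Type*} [NormedAddCommGroup E] [NormedSpace ℝ E] [FiniteDimensional ℝ E]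
    (L : E →L[ℝ] E) : Function.Bijective L ↔ ∀ v, L v = 0 → v = 0 := by
  have := LinearMap.injective_iff_surjective (f := (L : E →ₗ[ℝ] E))
  have h2 := injective_iff_map_eq_zero L
  constructor
  · intro h; exact h2.1 h.1
  · intro h; exact ⟨h2.2 h, this.1 (h2.2 h)⟩

lemma blk_bij {φ : ℝ × ℝ → ℝ × ℝ} {ψ : ℝ × ℝ → ℝ → ℝ} {x : ℝ × ℝ} {w : ℝ}
    (hφ : DifferentiableAt ℝ φ x)
    (hψ : DifferentiableAt ℝ (fun p : (ℝ × ℝ) × ℝ => ψ p.1 p.2) (x, w)) :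
    Function.Bijective
      (fderiv ℝ (fun p : (ℝ × ℝ) × ℝ => ((φ p.1, ψ p.1 p.2) : (ℝ × ℝ) × ℝ)) (x, w)) ↔
    Function.Bijective (fderiv ℝ φ x) ∧
      fderiv ℝ (fun p : (ℝ × ℝ) × ℝ => ψ p.1 p.2) (x, w) (0, 1) ≠ 0 := by
  rw [bij_iff_inj, bij_iff_inj]
  simp only [blk_apply hφ hψ, Prod.forall]
  set A := fderiv ℝ φ x
  set B := fderiv ℝ (fun p : (ℝ × ℝ) × ℝ => ψ p.1 p.2) (x, w)
  have hB : ∀ (v : ℝ × ℝ) (t : ℝ), B (v, t) = B (v, 0) + t * B (0, 1) := by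
    intro v t
    have : (v, t) = (v, (0:ℝ)) + t • ((0 : ℝ × ℝ), (1:ℝ)) := by simp
    rw [this, map_add, map_smul]; simp
  constructor
  · intro h
    have hne : B (0, 1) ≠ 0 := by
      intro h0
      have := h 0 0 1 (by
        have : B ((0, 0), 1) = 0 := h0
        rw [this]
        show (A 0, _) = _
        simp)
      simp at this
    refine ⟨?_, hne⟩
    intro a b hab
    have := h a b (-(B ((a, b), 0) / B (0, 1))) (by
      rw [hab, hB]
      simp; field_simp; simp)
    exact (Prod.ext_iff.1 this).1
  · rintro ⟨h1, h2⟩ a b c h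
    obtain ⟨h3, h4⟩ := Prod.ext_iff.1 h
    have h5 := h1 a b h3
    rw [h5] at h4 ⊢
    simp only [Prod.snd_zero] at h4
    rw [hB] at h4
    have : B ((0 : ℝ × ℝ), (0:ℝ)) = 0 := map_zero B
    rw [this, zero_add] at h4
    have : c = 0 := by simpa [h2] using h4
    rw [this]; rfl

lemma tangent_zero {S : (ℝ × ℝ) → (ℝ × ℝ) → ℝ} {F : (ℝ × ℝ) → ℝ → (ℝ × ℝ)}
    (hS : ContDiff ℝ (⊤ : ℕ∞) (fun p : (ℝ × ℝ) × (ℝ × ℝ) => S p.1 p.2))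
    (hF : ContDiff ℝ (⊤ : ℕ∞) (fun p : (ℝ × ℝ) × ℝ => F p.1 p.2))
    (hFS : ∀ x w, S x (F x w) = 0) (x : ℝ × ℝ) (w : ℝ) :
    fderiv ℝ (S x) (F x w) (deriv (F x) w) = 0 := by
  have h1 : Differentiable ℝ (S x) :=
    (hS.comp (contDiff_prodMk_right x)).differentiable (by simp)
  have h2 : Differentiable ℝ (F x) :=
    (hF.comp (contDiff_prodMk_right x)).differentiable (by simp)
  have h3 := (h1 (F x w)).hasFDerivAt.comp_hasDerivAt w (h2 w).hasDerivAt
  have h4 : (S x ∘ F x) = fun _ => 0 := by ext t; exact hFS x t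
  rw [h4] at h3
  exact h3.unique (hasDerivAt_const w 0)

lemma straighten {S : (ℝ × ℝ) → (ℝ × ℝ) → ℝ} {F : (ℝ × ℝ) → ℝ → (ℝ × ℝ)}
    (hS : ContDiff ℝ (⊤ : ℕ∞) (fun p : (ℝ × ℝ) × (ℝ × ℝ) => S p.1 p.2))
    (hSreg : ∀ x v, S x v = 0 → fderiv ℝ (S x) v ≠ 0)
    (hF : ContDiff ℝ (⊤ : ℕ∞) (fun p : (ℝ × ℝ) × ℝ => F p.1 p.2))
    (hFS : ∀ x w, S x (F x w) = 0)
    (hFreg : ∀ x w, deriv (F x) w ≠ 0) (x₀ : ℝ × ℝ) (w₀ : ℝ) :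
    ∃ (n : ℝ × ℝ) (ω σ : (ℝ × ℝ) × (ℝ × ℝ) → ℝ), fderiv ℝ (S x₀) (F x₀ w₀) n ≠ 0 ∧
      SmNear ω (x₀, F x₀ w₀) ∧ SmNear σ (x₀, F x₀ w₀) ∧ ω (x₀, F x₀ w₀) = w₀ ∧
      σ (x₀, F x₀ w₀) = 0 ∧
      ∀ᶠ q in 𝓝 (x₀, F x₀ w₀), F q.1 (ω q) + σ q • n = q.2 := by
  obtain ⟨n, hn⟩ : ∃ n, fderiv ℝ (S x₀) (F x₀ w₀) n ≠ 0 := by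
    by_contra! h
    exact hSreg _ _ (hFS x₀ w₀) (ContinuousLinearMap.ext h)
  let G : ((ℝ × ℝ) × ℝ) × ℝ → (ℝ × ℝ) × (ℝ × ℝ) := fun q => (q.1.1, F q.1.1 q.1.2 + q.2 • n)
  have hF1 : ContDiff ℝ (⊤ : ℕ∞) (fun q : ((ℝ × ℝ) × ℝ) × ℝ => F q.1.1 q.1.2) :=
    hF.comp contDiff_fst
  have hG : ContDiff ℝ (⊤ : ℕ∞) G := by
    apply ContDiff.prodMk (by fun_prop)
    exact hF1.add (by fun_prop)
  have hd : fderiv ℝ G ((x₀, w₀), 0) =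
      ((ContinuousLinearMap.fst ℝ (ℝ × ℝ) ℝ).comp (ContinuousLinearMap.fst ℝ ((ℝ × ℝ) × ℝ) ℝ)).prod
      ((fderiv ℝ (fun p : (ℝ × ℝ) × ℝ => F p.1 p.2) (x₀, w₀)).comp
          (ContinuousLinearMap.fst ℝ ((ℝ × ℝ) × ℝ) ℝ)
        + (ContinuousLinearMap.snd ℝ ((ℝ × ℝ) × ℝ) ℝ).smulRight n) := by
    apply HasFDerivAt.fderiv
    apply HasFDerivAt.prodMk
    · exact ((ContinuousLinearMap.fst ℝ (ℝ × ℝ) ℝ).comp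
        (ContinuousLinearMap.fst ℝ ((ℝ × ℝ) × ℝ) ℝ)).hasFDerivAt
    · apply HasFDerivAt.add
      · exact HasFDerivAt.comp (((x₀, w₀), 0) : ((ℝ × ℝ) × ℝ) × ℝ)
          (g := fun p : (ℝ × ℝ) × ℝ => F p.1 p.2) (f := Prod.fst)
          (hF.differentiable (by simp) (x₀, w₀)).hasFDerivAt hasFDerivAt_fst
      · exact ((ContinuousLinearMap.snd ℝ ((ℝ × ℝ) × ℝ) ℝ).smulRight n).hasFDerivAt
  have hinj : Function.Injective (fderiv ℝ G ((x₀, w₀), 0)) := by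
    rw [injective_iff_map_eq_zero]
    rintro ⟨⟨a, b⟩, c⟩ h
    rw [hd] at h
    obtain ⟨h1, h2⟩ := Prod.ext_iff.1 h
    have h1 : a = 0 := h1
    subst h1
    have h2 : fderiv ℝ (fun p : (ℝ × ℝ) × ℝ => F p.1 p.2) (x₀, w₀) (0, b) + c • n = 0 := h2
    have h3 : ((0 : ℝ × ℝ), b) = b • ((0 : ℝ × ℝ), (1:ℝ)) := by simp
    rw [h3, map_smul, ← (fderiv_uncurry (hF.differentiable (by simp) (x₀, w₀))).deriv] at h2
    have h4 := congrArg (fderiv ℝ (S x₀) (F x₀ w₀)) h2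
    rw [map_add, map_smul, map_smul, tangent_zero hS hF hFS, map_zero] at h4
    have h5 : c = 0 := by simpa [hn] using h4
    subst h5
    have h6 : b = 0 := by simpa [hFreg] using h2
    subst h6
    rfl
  let A : (((ℝ × ℝ) × ℝ) × ℝ) ≃L[ℝ] ((ℝ × ℝ) × (ℝ × ℝ)) :=
    (LinearEquiv.ofInjectiveOfFinrankEq ((fderiv ℝ G ((x₀, w₀), 0)) :
      (((ℝ × ℝ) × ℝ) × ℝ) →ₗ[ℝ] ((ℝ × ℝ) × (ℝ × ℝ))) hinj (by simp)).toContinuousLinearEquiv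
  have hA : fderiv ℝ G ((x₀, w₀), 0) = A := by ext <;> rfl
  obtain ⟨i, hi1, hi2, hi3⟩ := inverse_near hG _ A hA
  have hG0 : G ((x₀, w₀), 0) = (x₀, F x₀ w₀) := by simp [G]
  rw [hG0] at hi1 hi2 hi3
  refine ⟨n, fun q => (i q).1.2, fun q => (i q).2, hn, ?_, ?_, by simp [hi2], by simp [hi2], ?_⟩
  · exact SmNear.comp (g := fun p : ((ℝ × ℝ) × ℝ) × ℝ => p.1.2)
      (smNear_of_contDiff (by fun_prop) _) hi1
  · exact SmNear.comp (g := fun p : ((ℝ × ℝ) × ℝ) × ℝ => p.2)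
      (smNear_of_contDiff (by fun_prop) _) hi1
  · filter_upwards [hi3] with q hq
    obtain ⟨h1, h2⟩ := Prod.ext_iff.1 hq
    have h1 : (i q).1.1 = q.1 := h1
    rw [← h1]; exact h2

lemma hadamard_along {T : (ℝ × ℝ) × (ℝ × ℝ) → ℝ} {F : (ℝ × ℝ) → ℝ → (ℝ × ℝ)}
    (hF : ContDiff ℝ (⊤ : ℕ∞) (fun p : (ℝ × ℝ) × ℝ => F p.1 p.2))
    (x₀ : ℝ × ℝ) (w₀ : ℝ) (n : ℝ × ℝ) (d : ℝ) (hT : SmNear T (x₀, F x₀ w₀))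
    (hTF : ∀ᶠ p : (ℝ × ℝ) × ℝ in 𝓝 (x₀, w₀), T (p.1, F p.1 p.2) = 0)
    (hd : HasDerivAt (fun s : ℝ => T (x₀, F x₀ w₀ + s • n)) d 0) :
    ∃ a : ((ℝ × ℝ) × ℝ) × ℝ → ℝ, SmNear a ((x₀, w₀), 0) ∧
      (∀ᶠ q in 𝓝 (((x₀, w₀), 0) : ((ℝ × ℝ) × ℝ) × ℝ),
        T (q.1.1, F q.1.1 q.1.2 + q.2 • n) = q.2 * a q) ∧
      a ((x₀, w₀), 0) = d := by
  have hF1 : ContDiff ℝ (⊤ : ℕ∞) (fun q : ((ℝ × ℝ) × ℝ) × ℝ => F q.1.1 q.1.2) :=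
    hF.comp contDiff_fst
  have hG : ContDiff ℝ (⊤ : ℕ∞)
      (fun q : ((ℝ × ℝ) × ℝ) × ℝ => (q.1.1, F q.1.1 q.1.2 + q.2 • n)) :=
    ContDiff.prodMk (by fun_prop) (hF1.add (by fun_prop))
  have hf : SmNear (fun q : ((ℝ × ℝ) × ℝ) × ℝ => T (q.1.1, F q.1.1 q.1.2 + q.2 • n))
      ((x₀, w₀), 0) := by
    apply SmNear.comp (g := T) _ (smNear_of_contDiff hG _)
    simpa using hT
  obtain ⟨a, h1, h2, h3⟩ := hadamard _ _ hf (by simpa using hTF)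
  refine ⟨a, h1, h2, ?_⟩
  rw [h3]
  have hdf := ContDiffAt.differentiableAt (Eventually.self_of_nhds hf) (by simp)
  exact (fderiv_uncurry (f := fun (p : (ℝ × ℝ) × ℝ) (s : ℝ) => T (p.1, F p.1 p.2 + s • n))
    hdf).unique hd

/-- feedback relation differentiated in `w` -/
lemma psi_w {F F' : (ℝ × ℝ) → ℝ → (ℝ × ℝ)} {ψ : (ℝ × ℝ) → ℝ → ℝ} {x x' : ℝ × ℝ} {w : ℝ}
    (hF : ContDiff ℝ (⊤ : ℕ∞) (fun p : (ℝ × ℝ) × ℝ => F p.1 p.2))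
    (hF' : ContDiff ℝ (⊤ : ℕ∞) (fun p : (ℝ × ℝ) × ℝ => F' p.1 p.2))
    (L : (ℝ × ℝ) →L[ℝ] (ℝ × ℝ))
    (hψ : DifferentiableAt ℝ (fun p : (ℝ × ℝ) × ℝ => ψ p.1 p.2) (x, w))
    (h : ∀ᶠ t in 𝓝 w, L (F x t) = F' x' (ψ x t)) :
    L (deriv (F x) w) =
      fderiv ℝ (fun p : (ℝ × ℝ) × ℝ => ψ p.1 p.2) (x, w) (0, 1) • deriv (F' x') (ψ x w) := by
  have h1 : Differentiable ℝ (F x) :=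
    (hF.comp (contDiff_prodMk_right x)).differentiable (by simp)
  have h2 : Differentiable ℝ (F' x') :=
    (hF'.comp (contDiff_prodMk_right x')).differentiable (by simp)
  have h3 := L.hasFDerivAt.comp_hasDerivAt w (h1 w).hasDerivAt
  have h4 := (h2 (ψ x w)).hasDerivAt.scomp w (fderiv_uncurry hψ)
  exact (h3.congr_of_eventuallyEq (h.mono fun t ht => ht.symm)).unique h4

lemma dir1 (S S' : (ℝ × ℝ) → (ℝ × ℝ) → ℝ) (F F' : (ℝ × ℝ) → ℝ → (ℝ × ℝ))
    (x₀ x₀' : ℝ × ℝ) (w₀ w₀' : ℝ)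
    (hS' : ContDiff ℝ (⊤ : ℕ∞) (fun p : (ℝ × ℝ) × (ℝ × ℝ) => S' p.1 p.2))
    (hS'reg : ∀ x v, S' x v = 0 → fderiv ℝ (S' x) v ≠ 0)
    (hF : ContDiff ℝ (⊤ : ℕ∞) (fun p : (ℝ × ℝ) × ℝ => F p.1 p.2))
    (hF' : ContDiff ℝ (⊤ : ℕ∞) (fun p : (ℝ × ℝ) × ℝ => F' p.1 p.2))
    (hFS : ∀ x w, S x (F x w) = 0)
    (hF'S' : ∀ x w, S' x (F' x w) = 0)
    (hFreg : ∀ x w, deriv (F x) w ≠ 0)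
    (hF'reg : ∀ x w, deriv (F' x) w ≠ 0)
    (h : SubmanifoldsEquiv S S' F F' x₀ x₀' w₀ w₀') : FirstExtensionsEquiv F F' x₀ x₀' w₀ w₀' := by
  obtain ⟨φ, δ, U, V, hU, hxU, hV, hvV, hφ, hφb, hφ0, hφv, hδ, hδ0, heq⟩ := h
  obtain ⟨n, ω, σ, hn, hω, hσ, hω0, hσ0, hr⟩ := straighten hS' hS'reg hF' hF'S' hF'reg x₀' w₀'
  have hdS' : Differentiable ℝ (S' x₀') :=
    (hS'.comp (contDiff_prodMk_right x₀')).differentiable (by simp)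
  obtain ⟨a, ha, hae, ha0⟩ := hadamard_along (T := fun p => S' p.1 p.2) hF' x₀' w₀' n _
    (smNear_of_contDiff hS' _) (Eventually.of_forall fun p => hF'S' _ _)
    (line_deriv (ContinuousLinearMap.id ℝ _) (F' x₀' w₀') n (hdS' _))
  have hane : a ((x₀', w₀'), 0) ≠ 0 := by rw [ha0]; exact hn
  have hφs : SmNear φ x₀ := smNear_of_contDiffOn hφ hU hxU
  have hFc : Continuous (fun p : (ℝ × ℝ) × ℝ => F p.1 p.2) := hF.continuous
  let K : (ℝ × ℝ) × ℝ → (ℝ × ℝ) × (ℝ × ℝ) := fun p => (φ p.1, fderiv ℝ φ p.1 (F p.1 p.2))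
  have hfst : SmNear (Prod.fst : (ℝ × ℝ) × ℝ → ℝ × ℝ) (x₀, w₀) :=
    smNear_of_contDiff contDiff_fst _
  have hK : SmNear K (x₀, w₀) := by
    apply SmNear.prodMk
    · exact SmNear.comp (g := φ) (f := Prod.fst) hφs hfst
    · exact (SmNear.comp (g := fderiv ℝ φ) (f := Prod.fst) hφs.fderiv hfst).clm_apply
        (smNear_of_contDiff hF _)
  have hK0 : K (x₀, w₀) = (x₀', F' x₀' w₀') := by simp [K, hφ0, hφv]
  let Q : (ℝ × ℝ) × (ℝ × ℝ) → ((ℝ × ℝ) × ℝ) × ℝ := fun q => ((q.1, ω q), σ q)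
  have hQ : SmNear Q (x₀', F' x₀' w₀') :=
    ((smNear_of_contDiff contDiff_fst _).prodMk hω).prodMk hσ
  have hQ0 : Q (x₀', F' x₀' w₀') = ((x₀', w₀'), 0) := by simp [Q, hω0, hσ0]
  have hψ : SmNear (fun p => ω (K p)) (x₀, w₀) := by
    apply SmNear.comp (g := ω) _ hK
    rw [hK0]; exact hω
  have e1 : ∀ᶠ q in 𝓝 (x₀', F' x₀' w₀'), S' q.1 (F' q.1 (ω q) + σ q • n) = σ q * a (Q q) ∧
      a (Q q) ≠ 0 := by
    apply hQ.continuousAt.eventually (p := fun r => S' r.1.1 (F' r.1.1 r.1.2 + r.2 • n) = r.2 * a r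
      ∧ a r ≠ 0)
    rw [hQ0]
    exact hae.and (ha.continuousAt.eventually_ne hane)
  have e2 : ∀ᶠ p in 𝓝 (x₀, w₀), S' (K p).1 (K p).2 = 0 →
      (K p).2 = F' (K p).1 (ω (K p)) := by
    apply hK.continuousAt.eventually (p := fun q => S' q.1 q.2 = 0 → q.2 = F' q.1 (ω q))
    rw [hK0]
    filter_upwards [e1, hr] with q h1 h2 h3
    rw [h2, h3] at h1
    have : σ q = 0 := by
      rcases mul_eq_zero.1 h1.1.symm with h | h
      · exact h
      · exact absurd h h1.2
    rw [this] at h2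
    simpa using h2.symm
  have e3 : ∀ᶠ p : (ℝ × ℝ) × ℝ in 𝓝 (x₀, w₀), p.1 ∈ U ∧ F p.1 p.2 ∈ V :=
    (continuous_fst.continuousAt.eventually (hU.mem_nhds hxU)).and
      (hFc.continuousAt.eventually (hV.mem_nhds hvV))
  have e4 : ∀ᶠ p : (ℝ × ℝ) × ℝ in 𝓝 (x₀, w₀),
      p.1 ∈ U ∧ fderiv ℝ φ p.1 (F p.1 p.2) = F' (φ p.1) (ω (K p)) ∧
      ContDiffAt ℝ (⊤ : ℕ∞) (fun p => ω (K p)) p := by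
    filter_upwards [e2, e3, hψ] with p h2 h3 h4
    refine ⟨h3.1, ?_, h4⟩
    apply h2
    show S' (φ p.1) (fderiv ℝ φ p.1 (F p.1 p.2)) = 0
    rw [heq _ h3.1 _ h3.2, hFS, mul_zero]
  obtain ⟨U₁, W₁, hU₁, hx₁, hW₁, hw₁, hsub⟩ := mem_nhds_prod_iff'.1 e4
  have e5 : ∀ x ∈ U₁, ∀ w ∈ W₁, x ∈ U ∧ fderiv ℝ φ x (F x w) = F' (φ x) (ω (K (x, w))) ∧
      ContDiffAt ℝ (⊤ : ℕ∞) (fun p => ω (K p)) (x, w) := fun x hx w hw =>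
    hsub (show (x, w) ∈ U₁ ×ˢ W₁ from ⟨hx, hw⟩)
  have hsubU : U₁ ⊆ U := fun x hx => (e5 x hx w₀ hw₁).1
  refine ⟨φ, fun x w => ω (K (x, w)), U₁, W₁, hU₁, hx₁, hW₁, hw₁, hφ.mono hsubU,
    fun x hx => hφb x (hsubU hx), hφ0, ?_, ?_, ?_, fun x hx w hw => (e5 x hx w hw).2.1⟩
  · rintro ⟨x, w⟩ ⟨hx, hw⟩
    exact (e5 x hx w hw).2.2.contDiffWithinAt
  · simp [hK0, hω0]
  · intro x hx w hw
    have hψd : DifferentiableAt ℝ (fun p : (ℝ × ℝ) × ℝ => ω (K (p.1, p.2))) (x, w) :=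
      (e5 x hx w hw).2.2.differentiableAt (by simp)
    have hφd : DifferentiableAt ℝ φ x :=
      (hφ.contDiffAt (hU.mem_nhds (hsubU hx))).differentiableAt (by simp)
    refine (blk_bij (ψ := fun x w => ω (K (x, w))) hφd hψd).2 ⟨hφb x (hsubU hx), ?_⟩
    intro h0
    have h1 := psi_w (ψ := fun x w => ω (K (x, w))) (x' := φ x) hF hF' (fderiv ℝ φ x) hψd (by
      filter_upwards [hW₁.mem_nhds hw] with t ht
      exact (e5 x hx t ht).2.1)
    rw [h0, zero_smul] at h1
    exact hFreg x w ((bij_iff_inj _).1 (hφb x (hsubU hx)) _ h1)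

lemma dir2 (S S' : (ℝ × ℝ) → (ℝ × ℝ) → ℝ) (F F' : (ℝ × ℝ) → ℝ → (ℝ × ℝ))
    (x₀ x₀' : ℝ × ℝ) (w₀ w₀' : ℝ)
    (hS : ContDiff ℝ (⊤ : ℕ∞) (fun p : (ℝ × ℝ) × (ℝ × ℝ) => S p.1 p.2))
    (hS' : ContDiff ℝ (⊤ : ℕ∞) (fun p : (ℝ × ℝ) × (ℝ × ℝ) => S' p.1 p.2))
    (hSreg : ∀ x v, S x v = 0 → fderiv ℝ (S x) v ≠ 0)
    (hS'reg : ∀ x v, S' x v = 0 → fderiv ℝ (S' x) v ≠ 0)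
    (hF : ContDiff ℝ (⊤ : ℕ∞) (fun p : (ℝ × ℝ) × ℝ => F p.1 p.2))
    (hF' : ContDiff ℝ (⊤ : ℕ∞) (fun p : (ℝ × ℝ) × ℝ => F' p.1 p.2))
    (hFS : ∀ x w, S x (F x w) = 0)
    (hF'S' : ∀ x w, S' x (F' x w) = 0)
    (hFreg : ∀ x w, deriv (F x) w ≠ 0)
    (h : FirstExtensionsEquiv F F' x₀ x₀' w₀ w₀') : SubmanifoldsEquiv S S' F F' x₀ x₀' w₀ w₀' := by
  obtain ⟨φ, ψ, U, W, hU, hxU, hW, hwW, hφ, hφb, hφ0, hψ, hψ0, hΦ, heq⟩ := h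
  obtain ⟨n, ω, σ, hn, hω, hσ, hω0, hσ0, hr⟩ := straighten hS hSreg hF hFS hFreg x₀ w₀
  have hdS : Differentiable ℝ (S x₀) :=
    (hS.comp (contDiff_prodMk_right x₀)).differentiable (by simp)
  have hdS' : Differentiable ℝ (S' x₀') :=
    (hS'.comp (contDiff_prodMk_right x₀')).differentiable (by simp)
  have hφs : SmNear φ x₀ := smNear_of_contDiffOn hφ hU hxU
  set L := fderiv ℝ φ x₀ with hL
  have hLv : L (F x₀ w₀) = F' x₀' w₀' := by
    rw [hL, heq _ hxU _ hwW, hφ0, hψ0]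
  have hUW : IsOpen (U ×ˢ W) := hU.prod hW
  have hLn : fderiv ℝ (S' x₀') (L (F x₀ w₀)) (L n) ≠ 0 := by
    intro h0
    have hψd : DifferentiableAt ℝ (fun p : (ℝ × ℝ) × ℝ => ψ p.1 p.2) (x₀, w₀) :=
      (hψ.contDiffAt (hUW.mem_nhds ⟨hxU, hwW⟩)).differentiableAt (by simp)
    have h1 := psi_w (x' := x₀') hF hF' L hψd (by
      filter_upwards [hW.mem_nhds hwW] with t ht
      rw [hL, heq _ hxU _ ht, hφ0])
    rw [hLv] at h0
    have h2 : fderiv ℝ (S' x₀') (F' x₀' w₀') (L (deriv (F x₀) w₀)) = 0 := by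
      rw [h1, hψ0, map_smul, tangent_zero hS' hF' hF'S', smul_zero]
    apply hS'reg _ _ (hF'S' x₀' w₀')
    set t := deriv (F x₀) w₀ with ht
    have ht0 := tangent_zero hS hF hFS x₀ w₀
    rw [← ht] at ht0
    have htne : t ≠ 0 := hFreg _ _
    let M : (ℝ × ℝ) →L[ℝ] (ℝ × ℝ) :=
      (ContinuousLinearMap.fst ℝ ℝ ℝ).smulRight t + (ContinuousLinearMap.snd ℝ ℝ ℝ).smulRight n
    have hM : Function.Bijective M := by
      rw [bij_iff_inj]
      rintro ⟨b, c⟩ h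
      have h : b • t + c • n = 0 := h
      have h4 := congrArg (fderiv ℝ (S x₀) (F x₀ w₀)) h
      rw [map_add, map_smul, map_smul, ht0, map_zero] at h4
      have h5 : c = 0 := by simpa [hn] using h4
      subst h5
      have h6 : b = 0 := by simpa [htne] using h
      subst h6
      rfl
    refine ContinuousLinearMap.ext fun v' => ?_
    obtain ⟨v, rfl⟩ := (hφb x₀ hxU).2 v'
    obtain ⟨⟨b, c⟩, rfl⟩ := hM.2 v
    show fderiv ℝ (S' x₀') (F' x₀' w₀') (L (b • t + c • n)) = 0
    rw [map_add, map_smul, map_smul, map_add, map_smul, map_smul, h0, h2]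
    simp
  let T : (ℝ × ℝ) × (ℝ × ℝ) → ℝ := fun p => S' (φ p.1) (fderiv ℝ φ p.1 p.2)
  have hT : SmNear T (x₀, F x₀ w₀) := by
    have hfst : SmNear (Prod.fst : (ℝ × ℝ) × (ℝ × ℝ) → ℝ × ℝ) (x₀, F x₀ w₀) :=
      smNear_of_contDiff contDiff_fst _
    have h1 : SmNear (fun p : (ℝ × ℝ) × (ℝ × ℝ) => (φ p.1, fderiv ℝ φ p.1 p.2)) (x₀, F x₀ w₀) := by
      apply SmNear.prodMk
      · exact SmNear.comp (g := φ) (f := Prod.fst) hφs hfst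
      · exact (SmNear.comp (g := fderiv ℝ φ) (f := Prod.fst) hφs.fderiv hfst).clm_apply
          (smNear_of_contDiff contDiff_snd _)
    exact SmNear.comp (g := fun p : (ℝ × ℝ) × (ℝ × ℝ) => S' p.1 p.2)
      (smNear_of_contDiff hS' _) h1
  have hTF : ∀ᶠ p : (ℝ × ℝ) × ℝ in 𝓝 (x₀, w₀), T (p.1, F p.1 p.2) = 0 := by
    filter_upwards [hUW.mem_nhds ⟨hxU, hwW⟩] with p hp
    show S' (φ p.1) (fderiv ℝ φ p.1 (F p.1 p.2)) = 0
    rw [heq _ hp.1 _ hp.2, hF'S']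
  obtain ⟨a, ha, hae, ha0⟩ := hadamard_along (T := fun p => S p.1 p.2) hF x₀ w₀ n _
    (smNear_of_contDiff hS _) (Eventually.of_forall fun p => hFS _ _)
    (line_deriv (ContinuousLinearMap.id ℝ _) (F x₀ w₀) n (hdS _))
  obtain ⟨b, hb, hbe, hb0⟩ := hadamard_along (T := T) hF x₀ w₀ n
    (fderiv ℝ (S' x₀') (L (F x₀ w₀)) (L n)) hT hTF (by
      have := line_deriv L (F x₀ w₀) n (hdS' _)
      simpa only [T, hφ0] using this)
  have hane : a ((x₀, w₀), 0) ≠ 0 := by rw [ha0]; exact hn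
  have hbne : b ((x₀, w₀), 0) ≠ 0 := by rw [hb0]; exact hLn
  let Q : (ℝ × ℝ) × (ℝ × ℝ) → ((ℝ × ℝ) × ℝ) × ℝ := fun q => ((q.1, ω q), σ q)
  have hQ : SmNear Q (x₀, F x₀ w₀) :=
    ((smNear_of_contDiff contDiff_fst _).prodMk hω).prodMk hσ
  have hQ0 : Q (x₀, F x₀ w₀) = ((x₀, w₀), 0) := by simp [Q, hω0, hσ0]
  have hδ : SmNear (fun q => b (Q q) / a (Q q)) (x₀, F x₀ w₀) := by
    apply SmNear.comp (g := fun r => b r / a r) _ hQ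
    rw [hQ0]; exact hb.div ha hane
  have e1 : ∀ᶠ q in 𝓝 (x₀, F x₀ w₀), S q.1 (F q.1 (ω q) + σ q • n) = σ q * a (Q q) ∧
      a (Q q) ≠ 0 ∧ T (q.1, F q.1 (ω q) + σ q • n) = σ q * b (Q q) ∧ b (Q q) ≠ 0 := by
    apply hQ.continuousAt.eventually (p := fun r => S r.1.1 (F r.1.1 r.1.2 + r.2 • n) = r.2 * a r
      ∧ a r ≠ 0 ∧ T (r.1.1, F r.1.1 r.1.2 + r.2 • n) = r.2 * b r ∧ b r ≠ 0)
    rw [hQ0]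
    exact hae.and ((ha.continuousAt.eventually_ne hane).and
      (hbe.and (hb.continuousAt.eventually_ne hbne)))
  have e2 : ∀ᶠ q in 𝓝 (x₀, F x₀ w₀), q.1 ∈ U ∧
      ContDiffAt ℝ (⊤ : ℕ∞) (fun q => b (Q q) / a (Q q)) q ∧ b (Q q) / a (Q q) ≠ 0 ∧
      T q = b (Q q) / a (Q q) * S q.1 q.2 := by
    filter_upwards [e1, hr, hδ, continuous_fst.continuousAt.eventually (hU.mem_nhds hxU)]
      with q h1 h2 h3 h4
    rw [h2] at h1
    obtain ⟨k1, k2, k3, k4⟩ := h1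
    refine ⟨h4, h3, div_ne_zero k4 k2, ?_⟩
    rw [k1]
    have : T q = σ q * b (Q q) := k3
    rw [this]; field_simp
  obtain ⟨U₁, V₁, hU₁, hx₁, hV₁, hv₁, hsub⟩ := mem_nhds_prod_iff'.1 e2
  have e5 := fun (x : ℝ × ℝ) (hx : x ∈ U₁) (v : ℝ × ℝ) (hv : v ∈ V₁) =>
    hsub (show (x, v) ∈ U₁ ×ˢ V₁ from ⟨hx, hv⟩)
  have hsubU : U₁ ⊆ U := fun x hx => (e5 x hx _ hv₁).1
  refine ⟨φ, fun x v => b (Q (x, v)) / a (Q (x, v)), U₁, V₁, hU₁, hx₁, hV₁, hv₁, hφ.mono hsubU,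
    fun x hx => hφb x (hsubU hx), hφ0, hLv, ?_, fun x hx v hv => (e5 x hx v hv).2.2.1,
    fun x hx v hv => (e5 x hx v hv).2.2.2⟩
  rintro ⟨x, v⟩ ⟨hx, hv⟩
  exact (e5 x hx v hv).2.1.contDiffWithinAt

lemma dir3 (F F' : (ℝ × ℝ) → ℝ → (ℝ × ℝ))
    (x₀ x₀' : ℝ × ℝ) (w₀ w₀' : ℝ)
    (hF : ContDiff ℝ (⊤ : ℕ∞) (fun p : (ℝ × ℝ) × ℝ => F p.1 p.2)) :
    FirstExtensionsEquiv F F' x₀ x₀' w₀ w₀' ↔ SecondExtensionsEquiv F F' x₀ x₀' w₀ w₀' := by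
  constructor
  · rintro ⟨φ, ψ, U, W, hU, hxU, hW, hwW, hφ, hφb, hφ0, hψ, hψ0, hΦ, heq⟩
    have hUW : IsOpen (U ×ˢ W) := hU.prod hW
    have hφd : ∀ x ∈ U, DifferentiableAt ℝ φ x := fun x hx =>
      (hφ.contDiffAt (hU.mem_nhds hx)).differentiableAt (by simp)
    have hψd : ∀ p ∈ U ×ˢ W, DifferentiableAt ℝ (fun p : (ℝ × ℝ) × ℝ => ψ p.1 p.2) p :=
      fun p hp => (hψ.contDiffAt (hUW.mem_nhds hp)).differentiableAt (by simp)
    let B := fderiv ℝ (fun p : (ℝ × ℝ) × ℝ => ψ p.1 p.2)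
    have hBs : ContDiffOn ℝ (⊤ : ℕ∞) B (U ×ˢ W) := hψ.fderiv_of_isOpen hUW (by simp)
    have hB0 : ∀ p ∈ U ×ˢ W, B p (0, 1) ≠ 0 := fun p hp =>
      ((blk_bij (hφd p.1 hp.1) (hψd p hp)).1 (hΦ p.1 hp.1 p.2 hp.2)).2
    have hB1 : ContDiffOn ℝ (⊤ : ℕ∞) (fun p => B p (0, 1)) (U ×ˢ W) :=
      hBs.clm_apply contDiffOn_const
    have hBF : ContDiffOn ℝ (⊤ : ℕ∞) (fun p => B p (F p.1 p.2, 0)) (U ×ˢ W) :=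
      hBs.clm_apply (hF.contDiffOn.prodMk contDiffOn_const)
    refine ⟨φ, ψ, fun p => - B p (F p.1 p.2, 0) / B p (0, 1), fun p => 1 / B p (0, 1), U, W,
      hU, hxU, hW, hwW, hφ, hφ0, hψ, hψ0, hBF.neg.div hB1 hB0, contDiffOn_const.div hB1 hB0,
      fun p hp => one_div_ne_zero (hB0 p hp), fun p hp => hΦ p.1 hp.1 p.2 hp.2, ?_⟩
    rintro ⟨x, w⟩ hp
    have hb := hB0 _ hp
    rw [map_add, map_smul, map_smul, blk_apply (hφd x hp.1) (hψd _ hp),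
      blk_apply (hφd x hp.1) (hψd _ hp)]
    change (fderiv ℝ φ x (F x w), B (x, w) (F x w, 0)) + (- B (x, w) (F x w, 0) / B (x, w) (0, 1)) •
      (fderiv ℝ φ x 0, B (x, w) (0, 1)) = (F' (φ x) (ψ x w), 0) ∧
      (1 / B (x, w) (0, 1)) • (fderiv ℝ φ x 0, B (x, w) (0, 1)) = (0, 1)
    rw [map_zero, heq x hp.1 w hp.2]
    constructor
    · ext1
      · simp
      · simp [hb]
    · ext1
      · simp
      · simp [hb]
  · rintro ⟨φ, ψ, α, β, U, W, hU, hxU, hW, hwW, hφ, hφ0, hψ, hψ0, hα, hβ, hβ0, hΦ, heq⟩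
    have hUW : IsOpen (U ×ˢ W) := hU.prod hW
    have hφd : ∀ x ∈ U, DifferentiableAt ℝ φ x := fun x hx =>
      (hφ.contDiffAt (hU.mem_nhds hx)).differentiableAt (by simp)
    have hψd : ∀ p ∈ U ×ˢ W, DifferentiableAt ℝ (fun p : (ℝ × ℝ) × ℝ => ψ p.1 p.2) p :=
      fun p hp => (hψ.contDiffAt (hUW.mem_nhds hp)).differentiableAt (by simp)
    refine ⟨φ, ψ, U, W, hU, hxU, hW, hwW, hφ, ?_, hφ0, hψ, hψ0,
      fun x hx w hw => hΦ (x, w) ⟨hx, hw⟩, ?_⟩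
    · intro x hx
      exact ((blk_bij (hφd x hx) (hψd (x, w₀) ⟨hx, hwW⟩)).1 (hΦ (x, w₀) ⟨hx, hwW⟩)).1
    · intro x hx w hw
      have h1 := (heq (x, w) ⟨hx, hw⟩).1
      rw [blk_apply (hφd x hx) (hψd _ ⟨hx, hw⟩)] at h1
      simpa using (Prod.ext_iff.1 h1).1

end Aux

/-- for constraint submanifolds `{S = 0}`, `{S' = 0}` with regular
parametrisations (first extensions) `F`, `F'`, the local equivalence of the submanifolds,
the feedback equivalence of the first extensions, and the feedback equivalence of the
second extensions are all equivalent (around corresponding points). -/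
theorem stmt_0 (S S' : (ℝ × ℝ) → (ℝ × ℝ) → ℝ) (F F' : (ℝ × ℝ) → ℝ → (ℝ × ℝ))
    (x₀ x₀' : ℝ × ℝ) (w₀ w₀' : ℝ)
    (hS : ContDiff ℝ (⊤ : ℕ∞) (fun p : (ℝ × ℝ) × (ℝ × ℝ) => S p.1 p.2))
    (hS' : ContDiff ℝ (⊤ : ℕ∞) (fun p : (ℝ × ℝ) × (ℝ × ℝ) => S' p.1 p.2))
    (hSreg : ∀ x v, S x v = 0 → fderiv ℝ (S x) v ≠ 0)
    (hS'reg : ∀ x v, S' x v = 0 → fderiv ℝ (S' x) v ≠ 0)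
    (hF : ContDiff ℝ (⊤ : ℕ∞) (fun p : (ℝ × ℝ) × ℝ => F p.1 p.2))
    (hF' : ContDiff ℝ (⊤ : ℕ∞) (fun p : (ℝ × ℝ) × ℝ => F' p.1 p.2))
    (hFS : ∀ x w, S x (F x w) = 0)
    (hF'S' : ∀ x w, S' x (F' x w) = 0)
    (hFreg : ∀ x w, deriv (F x) w ≠ 0)
    (hF'reg : ∀ x w, deriv (F' x) w ≠ 0) :
    (SubmanifoldsEquiv S S' F F' x₀ x₀' w₀ w₀' ↔ FirstExtensionsEquiv F F' x₀ x₀' w₀ w₀') ∧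
    (FirstExtensionsEquiv F F' x₀ x₀' w₀ w₀' ↔ SecondExtensionsEquiv F F' x₀ x₀' w₀ w₀') := by
  exact ⟨⟨dir1 S S' F F' x₀ x₀' w₀ w₀' hS' hS'reg hF hF' hFS hF'S' hFreg hF'reg,
    dir2 S S' F F' x₀ x₀' w₀ w₀' hS hS' hSreg hS'reg hF hF' hFS hF'S' hFreg⟩,
    dir3 F F' x₀ x₀' w₀ w₀' hF⟩
end
end

section
/- Let S_q(x,ẋ) = ẋᵀg(x)ẋ + 2ω(x)ẋ + h(x) define a conic submanifold of Tℝ² which is nonempty near x₀ and satisfies Δ₁(x₀) ≠ 0. If Δ₂(x₀) > 0 then, locally around x₀, {S_q=0} is equivalent to {a²(ż−c₀)² + b²(ẏ−c₁)² = 1} for some smooth functions a, b, c₀, c₁ of x=(z,y) with a and b nonvanishing; if Δ₂(x₀) < 0 then, locally around x₀, {S_q=0} is equivalent to {a²(ż−c₀)² − b²(ẏ−c₁)² = 1} for some smooth a, b, c₀, c₁ with a and b nonvanishing. -/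
noncomputable section

open Set

/-- Local equivalence at `x₀` of the constraint submanifold `{S = 0} ⊆ Tℝ²` with
`{S' = 0}`, via a local diffeomorphism `φ` (with image in `V`) and a smooth nonvanishing
function `δ(x, ẋ)`: `S'(φ x, Dφ(x) ẋ) = δ(x, ẋ) · S(x, ẋ)`. -/
def LocEquivConic (S S' : (ℝ × ℝ) → (ℝ × ℝ) → ℝ) (x₀ : ℝ × ℝ) (V : Set (ℝ × ℝ)) : Prop :=
  ∃ (φ : (ℝ × ℝ) → (ℝ × ℝ)) (δ : (ℝ × ℝ) → (ℝ × ℝ) → ℝ) (U : Set (ℝ × ℝ)),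
    IsOpen U ∧ x₀ ∈ U ∧
    ContDiffOn ℝ (⊤ : ℕ∞) φ U ∧ (∀ x ∈ U, Function.Bijective (fderiv ℝ φ x)) ∧
    (∀ x ∈ U, φ x ∈ V) ∧
    ContDiffOn ℝ (⊤ : ℕ∞) (fun p : (ℝ × ℝ) × (ℝ × ℝ) => δ p.1 p.2) (U ×ˢ univ) ∧
    (∀ x ∈ U, ∀ v : ℝ × ℝ, δ x v ≠ 0) ∧
    (∀ x ∈ U, ∀ v : ℝ × ℝ, S' (φ x) (fderiv ℝ φ x v) = δ x v * S x v)

/-- Smoothness of parametric integrals over `[0,1]`. -/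
theorem contDiff_param_aux (n : ℕ) : ∀ {F : Type} [NormedAddCommGroup F] [NormedSpace ℝ F]
    [CompleteSpace F] (G : (ℝ × ℝ) × ℝ → F), ContDiff ℝ n G →
    ContDiff ℝ n (fun x : ℝ × ℝ => ∫ θ in (0:ℝ)..1, G (x, θ)) := by
  induction n with
  | zero =>
    intro F _ _ _ G hG
    have hG' : Continuous G := hG.continuous
    refine contDiff_zero.2 ?_
    exact intervalIntegral.continuous_parametric_intervalIntegral_of_continuous'
      (f := fun x θ => G (x, θ)) (by simpa [Function.uncurry_def] using hG') 0 1
  | succ n ih =>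
    intro F _ _ _ G hG
    have hGc : Continuous G := hG.continuous
    have hGd : Differentiable ℝ G := hG.differentiable (by norm_cast)
    let G' : (ℝ × ℝ) × ℝ → (ℝ × ℝ) →L[ℝ] F :=
      fun p => (fderiv ℝ G p).comp (ContinuousLinearMap.inl ℝ (ℝ × ℝ) ℝ)
    have hG' : ContDiff ℝ n G' :=
      (hG.fderiv_right (m := n) (by norm_cast)).clm_comp contDiff_const
    have hG'c : Continuous G' := hG'.continuous
    refine contDiff_succ_iff_hasFDerivAt.2 ⟨_, ih G' hG', fun x => ?_⟩
    have hK : IsCompact ((Metric.closedBall x 1) ×ˢ (Icc (0:ℝ) 1)) :=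
      (isCompact_closedBall x 1).prod isCompact_Icc
    obtain ⟨C, hC⟩ := hK.exists_bound_of_continuousOn hG'c.continuousOn
    refine intervalIntegral.hasFDerivAt_integral_of_dominated_of_fderiv_le
      (F := fun x θ => G (x, θ)) (F' := fun x θ => G' (x, θ)) (bound := fun _ => C)
      (Metric.closedBall_mem_nhds x one_pos) ?_ ?_ ?_ ?_ ?_ ?_
    · exact Filter.Eventually.of_forall fun y =>
        (Continuous.aestronglyMeasurable (by fun_prop))
    · exact Continuous.intervalIntegrable (by fun_prop) _ _
    · exact (Continuous.aestronglyMeasurable (by fun_prop))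
    · refine Filter.Eventually.of_forall fun t ht y hy => hC _ ⟨hy, ?_⟩
      rw [uIoc_of_le zero_le_one] at ht
      exact ⟨ht.1.le, ht.2⟩
    · exact intervalIntegrable_const
    · refine Filter.Eventually.of_forall fun t ht y hy => ?_
      exact (hGd (y, t)).hasFDerivAt.comp y (hasFDerivAt_prodMk_left y t)

/-- global solutions -/
theorem exists_sol (F : ℝ × ℝ → ℝ) (hF : ContDiff ℝ (⊤ : ℕ∞) F) (hc : HasCompactSupport F) :
    ∃ X : ℝ → ℝ → ℝ, (∀ s, X s 0 = s) ∧ ∀ s t, HasDerivAt (X s) (F (X s t, t)) t := by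
  have hFc : Continuous F := hF.continuous
  obtain ⟨K, hK⟩ := (hF.of_le (by norm_cast) : ContDiff ℝ 1 F).lipschitzWith_of_hasCompactSupport hc one_ne_zero
  obtain ⟨L, hL⟩ := hFc.bounded_above_of_compact_support hc
  obtain ⟨R, hR⟩ := hc.isCompact.isBounded.subset_closedBall (0 : ℝ × ℝ)
  have hL0 : 0 ≤ L := (norm_nonneg _).trans (hL 0)
  set T : ℝ := max R 1 with hT
  have hT0 : 0 < T := lt_of_lt_of_le one_pos (le_max_right _ _)
  have hzero : ∀ x t : ℝ, T < |t| → F (x, t) = 0 := by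
    intro x t ht
    by_contra hne
    have h1 := hR (subset_tsupport F (by simpa using hne : (x, t) ∈ Function.support F))
    rw [mem_closedBall_zero_iff, Prod.norm_def] at h1
    have h2 : |t| ≤ R := (le_max_right _ _).trans h1
    exact absurd (h2.trans (le_max_left R 1)) (not_le.2 ht)
  have hloc : ∀ s : ℝ, ∃ Y : ℝ → ℝ, Y 0 = s ∧
      ∀ t ∈ Icc (-T) T, HasDerivWithinAt Y (F (Y t, t)) (Icc (-T) T) t := by
    intro s
    have hpl : IsPicardLindelof (fun t x => F (x, t)) (tmin := -T) (tmax := T)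
        ⟨0, by constructor <;> linarith⟩ s (L.toNNReal * T.toNNReal) 0 L.toNNReal K := by
      constructor
      · intro t _
        refine LipschitzWith.lipschitzOnWith ?_
        simpa using! hK.comp (LipschitzWith.prodMk_right t)
      · intro x _
        exact Continuous.continuousOn (by fun_prop)
      · intro t _ x _
        simpa [Real.coe_toNNReal L hL0] using hL (x, t)
      · simp [Real.coe_toNNReal L hL0, Real.coe_toNNReal T hT0.le]
    exact hpl.exists_eq_forall_mem_Icc_hasDerivWithinAt₀
  choose Y hY0 hY using hloc
  let c : ℝ → ℝ := fun t => max (-T) (min t T)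
  have hcc : Continuous c := by fun_prop
  have hcm : ∀ t, c t ∈ Icc (-T) T := fun t =>
    ⟨le_max_left _ _, max_le (by linarith) (min_le_right _ _)⟩
  have hci : ∀ t ∈ Icc (-T) T, c t = t := fun t ht => by
    simp only [c]; rw [min_eq_left ht.2, max_eq_right ht.1]
  have hYc : ∀ s, Continuous fun t => F (Y s (c t), t) := by
    intro s
    have h1 : ContinuousOn (Y s) (Icc (-T) T) := fun t ht => (hY s t ht).continuousWithinAt
    have h2 : Continuous fun t => Y s (c t) := h1.comp_continuous hcc hcm
    exact hFc.comp (h2.prodMk continuous_id)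
  let X : ℝ → ℝ → ℝ := fun s t => s + ∫ τ in (0:ℝ)..t, F (Y s (c τ), τ)
  have hXd : ∀ s t, HasDerivAt (X s) (F (Y s (c t), t)) t := fun s t =>
    ((hYc s).integral_hasStrictDerivAt 0 t).hasDerivAt.const_add s
  have hXY : ∀ s, ∀ t ∈ Icc (-T) T, X s t = Y s t := by
    intro s t ht
    have hconv : Convex ℝ (Icc (-T) T) := convex_Icc _ _
    have := hconv.is_const_of_fderivWithin_eq_zero (𝕜 := ℝ) (f := fun t => X s t - Y s t) (x := t) (y := 0)
      (fun u hu => ((hXd s u).hasDerivWithinAt.sub (hY s u hu)).differentiableWithinAt) ?_ ht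
      ⟨by linarith, by linarith⟩
    · simp only [hY0, X, intervalIntegral.integral_same] at this
      simp only [X]
      linarith
    · intro u hu
      have h1 := ((hXd s u).hasDerivWithinAt (s := Icc (-T) T)).sub (hY s u hu)
      rw [hci u hu, sub_self] at h1
      have h2 := h1.hasFDerivWithinAt.fderivWithin (uniqueDiffOn_Icc (by linarith) u hu)
      rw [show (fun t => X s t - Y s t) = X s - Y s from rfl, h2]
      ext; simp
  refine ⟨X, fun s => by simp [X], fun s t => ?_⟩
  convert! hXd s t using 1
  by_cases ht : t ∈ Icc (-T) T
  · rw [hXY s t ht, hci t ht]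
  · have : T < |t| := by
      rw [mem_Icc, ← abs_le] at ht
      exact not_le.1 ht
    rw [hzero _ _ this, hzero _ _ this]

/-- The smooth flow of a scalar time dependent compactly supported vector field. -/
theorem exists_flow (F : ℝ × ℝ → ℝ) (hF : ContDiff ℝ (⊤ : ℕ∞) F) (hc : HasCompactSupport F) :
    ∃ X : ℝ × ℝ → ℝ, ContDiff ℝ (⊤ : ℕ∞) X ∧ (∀ s, X (s, 0) = s) ∧
      ∃ E : ℝ × ℝ → ℝ, ContDiff ℝ (⊤ : ℕ∞) E ∧ (∀ p, 0 < E p) ∧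
        ∀ p w : ℝ × ℝ, fderiv ℝ X p w = E p * w.1 + F (X p, p.2) * w.2 := by
  have hFc : Continuous F := hF.continuous
  have hFd : Differentiable ℝ F := hF.differentiable (by norm_cast)
  obtain ⟨K, hK⟩ := (hF.of_le (by norm_cast) : ContDiff ℝ 1 F).lipschitzWith_of_hasCompactSupport
    hc one_ne_zero
  obtain ⟨L, hL⟩ := hFc.bounded_above_of_compact_support hc
  have hL0 : 0 ≤ L := (norm_nonneg _).trans (hL 0)
  obtain ⟨X, hX0, hXd⟩ := exists_sol F hF hc
  let Fx : ℝ × ℝ → ℝ := fun p => fderiv ℝ F p (1, 0)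
  have hFx : ContDiff ℝ (⊤ : ℕ∞) Fx :=
    (hF.fderiv_right (m := (⊤ : ℕ∞)) (by norm_cast)).clm_apply contDiff_const
  have hFxc : Continuous Fx := hFx.continuous
  have hFxK : ∀ p, ‖Fx p‖ ≤ K := by
    intro p
    have h1 := (fderiv ℝ F p).le_opNorm (1, 0)
    have h2 : ‖fderiv ℝ F p‖ ≤ K := norm_fderiv_le_of_lipschitz ℝ hK
    have h3 : ‖((1:ℝ), (0:ℝ))‖ = 1 := by simp [Prod.norm_def]
    rw [h3, mul_one] at h1
    exact h1.trans h2
  let H : ℝ → ℝ → ℝ → ℝ := fun x x' t => ∫ θ in (0:ℝ)..1, Fx (x + θ * (x' - x), t)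
  have hHc : Continuous fun p : ℝ × ℝ × ℝ => H p.1 p.2.1 p.2.2 :=
    intervalIntegral.continuous_parametric_intervalIntegral_of_continuous'
      (f := fun (p : ℝ × ℝ × ℝ) θ => Fx (p.1 + θ * (p.2.1 - p.1), p.2.2))
      (by simp only [Function.uncurry_def]; fun_prop) 0 1
  have hHF : ∀ x x' t, F (x', t) - F (x, t) = H x x' t * (x' - x) := by
    intro x x' t
    have h1 : ∀ θ ∈ uIcc (0:ℝ) 1, HasDerivAt (fun θ => F (x + θ * (x' - x), t))
        (Fx (x + θ * (x' - x), t) * (x' - x)) θ := by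
      intro θ _
      have h2 : HasDerivAt (fun θ : ℝ => (x + θ * (x' - x), t)) (x' - x, 0) θ := by
        have h3 : HasDerivAt (fun θ : ℝ => x + θ * (x' - x)) (x' - x) θ := by
          simpa using ((hasDerivAt_id θ).mul_const (x' - x)).const_add x
        exact h3.prodMk (hasDerivAt_const θ t)
      have h4 := (hFd (x + θ * (x' - x), t)).hasFDerivAt.comp_hasDerivAt θ h2
      convert! h4 using 1
      have : ((x' - x, (0:ℝ)) : ℝ × ℝ) = (x' - x) • ((1:ℝ), (0:ℝ)) := by simp
      rw [this, map_smul, smul_eq_mul, mul_comm]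
    have h5 := intervalIntegral.integral_eq_sub_of_hasDerivAt h1
      (Continuous.intervalIntegrable (by fun_prop) _ _)
    rw [intervalIntegral.integral_mul_const] at h5
    simp only [H]
    rw [h5]
    simp
  have hHK : ∀ x x' t, ‖H x x' t‖ ≤ K := by
    intro x x' t
    have := intervalIntegral.norm_integral_le_of_norm_le_const (a := (0:ℝ)) (b := 1) (C := K)
      (f := fun θ => Fx (x + θ * (x' - x), t)) (fun θ _ => hFxK _)
    simpa using this
  have hXt : ∀ s, Continuous (X s) := fun s =>
    continuous_iff_continuousAt.2 fun t => (hXd s t).continuousAt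
  have hdiff : ∀ s s' t, X s' t - X s t =
      (s' - s) * Real.exp (∫ τ in (0:ℝ)..t, H (X s τ) (X s' τ) τ) := by
    intro s s' t
    have hA : Continuous fun τ => H (X s τ) (X s' τ) τ :=
      hHc.comp ((hXt s).prodMk ((hXt s').prodMk continuous_id))
    have hd : ∀ t, HasDerivAt (fun t => (X s' t - X s t) *
        Real.exp (-∫ τ in (0:ℝ)..t, H (X s τ) (X s' τ) τ)) 0 t := by
      intro t
      have h1 := (hXd s' t).sub (hXd s t)
      have h2 := (hA.integral_hasStrictDerivAt 0 t).hasDerivAt.neg.exp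
      have h3 := h1.mul h2
      convert! h3 using 1
      rw [hHF]
      simp only [Pi.sub_apply, Pi.neg_apply]
      ring
    have h4 := is_const_of_deriv_eq_zero (fun t => (hd t).differentiableAt)
      (fun t => (hd t).deriv) t 0
    simp only [hX0, intervalIntegral.integral_same, neg_zero, Real.exp_zero, mul_one] at h4
    rw [← h4, mul_assoc, ← Real.exp_add]
    simp
  -- joint continuity
  have hXs : ∀ t, Continuous fun s => X s t := by
    intro t
    have hlip : LipschitzWith (Real.exp (K * |t|)).toNNReal (fun s => X s t) := by
      refine LipschitzWith.of_dist_le_mul fun s' s => ?_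
      rw [Real.dist_eq, Real.dist_eq, hdiff s s' t, abs_mul, Real.abs_exp,
        Real.coe_toNNReal _ (Real.exp_pos _).le, mul_comm]
      refine mul_le_mul_of_nonneg_right (Real.exp_le_exp.2 ?_) (abs_nonneg _)
      have := intervalIntegral.norm_integral_le_of_norm_le_const (a := (0:ℝ)) (b := t) (C := K)
        (f := fun τ => H (X s τ) (X s' τ) τ) (fun θ _ => hHK _ _ _)
      rw [sub_zero] at this
      exact (le_abs_self _).trans this
    exact hlip.continuous
  have hXc : Continuous fun p : ℝ × ℝ => X p.1 p.2 := by
    refine continuous_prod_of_continuous_lipschitzWith' (fun p : ℝ × ℝ => X p.1 p.2) L.toNNReal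
      (fun s => ?_) hXs
    refine lipschitzWith_of_nnnorm_deriv_le (fun t => (hXd s t).differentiableAt) fun t => ?_
    rw [(hXd s t).deriv, ← NNReal.coe_le_coe, Real.coe_toNNReal L hL0]
    exact hL _
  let E : ℝ → ℝ → ℝ := fun s t => Real.exp (t * ∫ θ in (0:ℝ)..1, Fx (X s (t * θ), t * θ))
  have hE : ∀ s t, E s t = Real.exp (∫ τ in (0:ℝ)..t, H (X s τ) (X s τ) τ) := by
    intro s t
    simp only [E]
    rw [intervalIntegral.mul_integral_comp_mul_left (f := fun τ => Fx (X s τ, τ))]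
    simp [H]
  have hEc : Continuous fun p : ℝ × ℝ => E p.1 p.2 := by
    refine Real.continuous_exp.comp (continuous_snd.mul ?_)
    refine intervalIntegral.continuous_parametric_intervalIntegral_of_continuous'
      (f := fun (p : ℝ × ℝ) θ => Fx (X p.1 (p.2 * θ), p.2 * θ)) ?_ 0 1
    simp only [Function.uncurry_def]
    refine hFxc.comp (Continuous.prodMk ?_ (by fun_prop))
    exact hXc.comp (f := fun q : (ℝ × ℝ) × ℝ => (q.1.1, q.1.2 * q.2)) (by fun_prop)
  have hXs' : ∀ s t, HasDerivAt (fun s => X s t) (E s t) s := by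
    intro s t
    rw [hasDerivAt_iff_tendsto_slope]
    have hcont : Continuous fun s' => Real.exp (∫ τ in (0:ℝ)..t, H (X s τ) (X s' τ) τ) := by
      refine Real.continuous_exp.comp ?_
      refine intervalIntegral.continuous_parametric_intervalIntegral_of_continuous'
        (f := fun s' τ => H (X s τ) (X s' τ) τ) ?_ 0 t
      simp only [Function.uncurry_def]
      exact hHc.comp (((hXt s).comp continuous_snd).prodMk (hXc.prodMk continuous_snd))
    have h1 := (hcont.tendsto s).mono_left (nhdsWithin_le_nhds (s := {s}ᶜ))
    rw [← hE] at h1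
    refine h1.congr' ?_
    filter_upwards [self_mem_nhdsWithin] with s' hs'
    have hne : s' - s ≠ 0 := sub_ne_zero.2 hs'
    rw [slope_def_field, hdiff]
    field_simp
  let X' : ℝ × ℝ → ℝ := fun p => X p.1 p.2
  let E' : ℝ × ℝ → ℝ := fun p => E p.1 p.2
  have hfd : ∀ p, HasFDerivAt X' ((E' p) • ContinuousLinearMap.fst ℝ ℝ ℝ +
      (F (X' p, p.2)) • ContinuousLinearMap.snd ℝ ℝ ℝ) p := by
    intro p
    have h1 := hasStrictFDerivAt_uncurry_coprod (𝕜 := ℝ) (u := p) (f := X)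
      (f₁ := fun s t => (ContinuousLinearMap.toSpanSingleton ℝ (E s t)))
      (f₂ := fun s t => (ContinuousLinearMap.toSpanSingleton ℝ (F (X s t, t))))
      (Filter.Eventually.of_forall fun v => (hXs' v.1 v.2).hasFDerivAt)
      (Filter.Eventually.of_forall fun v => (hXd v.1 v.2).hasFDerivAt)
      (Continuous.continuousAt ?_) (Continuous.continuousAt ?_)
    · convert! h1.hasFDerivAt using 1
      ext <;> simp [X', E', Function.HasUncurry.uncurry]
    · exact (ContinuousLinearMap.toSpanSingletonCLE (𝕜 := ℝ) (E := ℝ)).continuous.comp hEc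
    · exact (ContinuousLinearMap.toSpanSingletonCLE (𝕜 := ℝ) (E := ℝ)).continuous.comp
        (hFc.comp (hXc.prodMk continuous_snd))
  have hEn : ∀ n : ℕ, ContDiff ℝ n X' → ContDiff ℝ n E' := by
    intro n hn
    have h1 := contDiff_param_aux n (fun q : (ℝ × ℝ) × ℝ =>
      Fx (X' (q.1.1, q.1.2 * q.2), q.1.2 * q.2)) ?_
    · exact (contDiff_snd.mul h1).exp
    · refine (hFx.of_le (by norm_cast; exact le_top)).comp (ContDiff.prodMk ?_ (by fun_prop))
      exact hn.comp (by fun_prop)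
  have hXn : ∀ n : ℕ, ContDiff ℝ n X' := by
    intro n
    induction n with
    | zero => exact contDiff_zero.2 hXc
    | succ n ih =>
      refine contDiff_succ_iff_hasFDerivAt.2 ⟨_, ?_, hfd⟩
      have h1 : ContDiff ℝ n (fun p : ℝ × ℝ => F (X' p, p.2)) :=
        (hF.of_le (by norm_cast; exact le_top)).comp (ih.prodMk contDiff_snd)
      exact ((hEn n ih).smul contDiff_const).add (h1.smul contDiff_const)
  refine ⟨X', contDiff_infty.2 hXn, hX0, E', contDiff_infty.2 fun n => hEn n (hXn n),
    fun p => Real.exp_pos _, fun p w => ?_⟩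
  rw [(hfd p).fderiv]
  simp

/-- Transfer: a pull-back normal form gives a local equivalence. -/
theorem locEquiv_of_pullback (S S' : (ℝ × ℝ) → (ℝ × ℝ) → ℝ) (x₀ p₀ : ℝ × ℝ) (W : Set (ℝ × ℝ))
    (hW : IsOpen W) (hp₀ : p₀ ∈ W) (ψ : ℝ × ℝ → ℝ × ℝ) (hψ : ContDiff ℝ (⊤ : ℕ∞) ψ)
    (hψ0 : ψ p₀ = x₀) (hbij : ∀ p, Function.Bijective (fderiv ℝ ψ p)) (lam : ℝ × ℝ → ℝ)
    (hlam : ContDiffOn ℝ (⊤ : ℕ∞) lam W) (hlam0 : ∀ p ∈ W, lam p ≠ 0)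
    (hid : ∀ p ∈ W, ∀ w, S' p w = lam p * S (ψ p) (fderiv ℝ ψ p w)) :
    LocEquivConic S S' x₀ W := by
  let e' : ∀ p, (ℝ × ℝ) ≃L[ℝ] (ℝ × ℝ) := fun p =>
    (LinearEquiv.ofBijective (fderiv ℝ ψ p).toLinearMap (hbij p)).toContinuousLinearEquiv
  have he' : ∀ p, HasFDerivAt ψ (e' p : (ℝ × ℝ) →L[ℝ] (ℝ × ℝ)) p := by
    intro p
    have h1 := (hψ.differentiable (by norm_cast) p).hasFDerivAt
    convert! h1 using 1
  let e := hψ.contDiffAt.toOpenPartialHomeomorph ψ (he' p₀) (by norm_cast)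
  have hec : ∀ p, e p = ψ p := fun p => rfl
  have hes : p₀ ∈ e.source := hψ.contDiffAt.mem_toOpenPartialHomeomorph_source (he' p₀) _
  have hsymm : ∀ x ∈ e.target, HasFDerivAt e.symm
      ((e' (e.symm x)).symm : (ℝ × ℝ) →L[ℝ] (ℝ × ℝ)) x := fun x hx =>
    e.hasFDerivAt_symm hx (he' _)
  have hsm : ContDiffOn ℝ (⊤ : ℕ∞) e.symm e.target := fun x hx =>
    (e.contDiffAt_symm hx (he' _) hψ.contDiffAt).contDiffWithinAt
  refine ⟨e.symm, fun x _ => lam (e.symm x), e.target ∩ e.symm ⁻¹' W,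
    e.symm.isOpen_inter_preimage hW, ⟨?_, ?_⟩, hsm.mono inter_subset_left, ?_, fun x hx => hx.2,
    ?_, fun x hx _ => hlam0 _ hx.2, ?_⟩
  · rw [← hψ0]; exact e.map_source hes
  · rw [mem_preimage, ← hψ0, ← hec, e.left_inv hes]; exact hp₀
  · intro x hx
    rw [(hsymm x hx.1).fderiv]
    exact (e' (e.symm x)).symm.bijective
  · refine (hlam.comp (hsm.mono inter_subset_left) fun x hx => hx.2).comp contDiffOn_fst ?_
    intro q hq
    exact hq.1
  · intro x hx v
    rw [hid _ hx.2, (hsymm x hx.1).fderiv]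
    have h1 : ψ (e.symm x) = x := e.right_inv hx.1
    have h2 : fderiv ℝ ψ (e.symm x) ((e' (e.symm x)).symm v) = v := by
      rw [(he' (e.symm x)).fderiv]
      simp
    rw [h1]
    congr 2

/-- The algebraic identity behind the normal form. -/
theorem conic_alg (g11 g12 g22 o1 o2 h u1 u2 D1 D2 m11 m12 E f a2 b2 c0 c1 t1 t2 σ τ ε : ℝ)
    (hD2 : D2 = g11 * g22 - g12 ^ 2)
    (hD1 : D1 = g11 * (g22 * h - o2 ^ 2) - g12 * (g12 * h - o1 * o2) + o1 * (g12 * o2 - g22 * o1))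
    (hD20 : D2 ≠ 0) (hD10 : D1 ≠ 0) (hE : E ≠ 0)
    (hm11 : m11 = g11 * u1 ^ 2 + 2 * g12 * u1 * u2 + g22 * u2 ^ 2)
    (hm12 : m12 = -g11 * u1 * u2 + g12 * (u1 ^ 2 - u2 ^ 2) + g22 * u1 * u2)
    (hm0 : m11 ≠ 0) (hu : u1 ^ 2 + u2 ^ 2 ≠ 0) (hf : f = m12 / m11)
    (ha : a2 = -(m11 * D2 / D1) * E ^ 2)
    (hb : ε * b2 = -((u1 ^ 2 + u2 ^ 2) ^ 2 * D2 / m11 * D2 / D1))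
    (ht1 : t1 = (u1 * ((g12 * o2 - g22 * o1) / D2) + u2 * ((g12 * o1 - g11 * o2) / D2))
      / (u1 ^ 2 + u2 ^ 2))
    (ht2 : t2 = (-u2 * ((g12 * o2 - g22 * o1) / D2) + u1 * ((g12 * o1 - g11 * o2) / D2))
      / (u1 ^ 2 + u2 ^ 2))
    (hc0 : c0 = (t1 + f * t2) / E) (hc1 : c1 = t2) (v1 v2 : ℝ)
    (hv1 : v1 = u1 * (E * σ - f * τ) - u2 * τ) (hv2 : v2 = u2 * (E * σ - f * τ) + u1 * τ) :
    a2 * (σ - c0) ^ 2 + ε * (b2 * (τ - c1) ^ 2) - 1 =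
      -(D2 / D1) * (g11 * v1 ^ 2 + 2 * g12 * v1 * v2 + g22 * v2 ^ 2
        + 2 * (o1 * v1 + o2 * v2) + h) := by
  set k1 := (g12 * o2 - g22 * o1) / D2 with hk1
  set k2 := (g12 * o1 - g11 * o2) / D2 with hk2
  have e1 : k1 = u1 * t1 - u2 * t2 := by rw [ht1, ht2]; field_simp; ring
  have e2 : k2 = u2 * t1 + u1 * t2 := by rw [ht1, ht2]; field_simp; ring
  -- completing the square
  have r1 : g11 * k1 + g12 * k2 = -o1 := by
    rw [hk1, hk2]; field_simp; rw [hD2]; ring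
  have r2 : g12 * k1 + g22 * k2 = -o2 := by
    rw [hk1, hk2]; field_simp; rw [hD2]; ring
  have r3 : o1 * k1 + o2 * k2 + h = D1 / D2 := by
    rw [hk1, hk2]; field_simp; rw [hD2, hD1]; ring
  have sq : g11 * v1 ^ 2 + 2 * g12 * v1 * v2 + g22 * v2 ^ 2 + 2 * (o1 * v1 + o2 * v2) + h
      = g11 * (v1 - k1) ^ 2 + 2 * g12 * (v1 - k1) * (v2 - k2) + g22 * (v2 - k2) ^ 2 + D1 / D2 := by
    rw [← r3]
    linear_combination (2 * v1 - k1) * r1 + (2 * v2 - k2) * r2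
  have quad : g11 * (v1 - k1) ^ 2 + 2 * g12 * (v1 - k1) * (v2 - k2) + g22 * (v2 - k2) ^ 2
      = m11 * (E * (σ - c0)) ^ 2 + (u1 ^ 2 + u2 ^ 2) ^ 2 * D2 / m11 * (τ - c1) ^ 2 := by
    have hEc : E * (σ - c0) = (E * σ - f * τ - t1) + f * (τ - t2) := by
      rw [hc0]; field_simp; ring
    rw [hEc, e1, e2, hv1, hv2, hc1]
    generalize E * σ - f * τ = η
    have hm : f * m11 = m12 := by rw [hf]; field_simp
    have hdet : (u1 ^ 2 + u2 ^ 2) ^ 2 * D2 / m11 =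
        (g11 * u2 ^ 2 - 2 * g12 * u1 * u2 + g22 * u1 ^ 2) - f ^ 2 * m11 := by
      rw [hf]; field_simp; rw [hD2, hm12, hm11]; ring
    rw [hdet]
    have hm' := hm
    rw [hm11] at hm' ⊢
    rw [hm12] at hm'
    linear_combination (-2 * (η - t1) * (τ - t2)) * hm'
  rw [sq, quad, ha]
  have : ε * (b2 * (τ - c1) ^ 2) = (ε * b2) * (τ - c1) ^ 2 := by ring
  rw [this, hb]
  field_simp
  ring

/-- Normal form, given a direction `u` of the right sign. -/
theorem conic_main (g11 g12 g22 ω1 ω2 h : (ℝ × ℝ) → ℝ) (x₀ : ℝ × ℝ)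
    (hg11 : ContDiff ℝ (⊤ : ℕ∞) g11) (hg12 : ContDiff ℝ (⊤ : ℕ∞) g12)
    (hg22 : ContDiff ℝ (⊤ : ℕ∞) g22) (hω1 : ContDiff ℝ (⊤ : ℕ∞) ω1)
    (hω2 : ContDiff ℝ (⊤ : ℕ∞) ω2) (hh : ContDiff ℝ (⊤ : ℕ∞) h)
    (D1 D2 : ℝ × ℝ → ℝ)
    (hD1 : D1 = fun x => g11 x * (g22 x * h x - ω2 x ^ 2) - g12 x * (g12 x * h x - ω1 x * ω2 x)
        + ω1 x * (g12 x * ω2 x - g22 x * ω1 x))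
    (hD2 : D2 = fun x => g11 x * g22 x - g12 x ^ 2) (ε : ℝ) (hε : ε * ε = 1)
    (hεD : 0 < ε * D2 x₀) (u1 u2 : ℝ)
    (hu : 0 < -((g11 x₀ * u1 ^ 2 + 2 * g12 x₀ * u1 * u2 + g22 x₀ * u2 ^ 2) * D2 x₀ / D1 x₀)) :
    ∃ (a b c0 c1 : (ℝ × ℝ) → ℝ) (V : Set (ℝ × ℝ)), IsOpen V ∧
        ContDiffOn ℝ (⊤ : ℕ∞) a V ∧ ContDiffOn ℝ (⊤ : ℕ∞) b V ∧
        ContDiffOn ℝ (⊤ : ℕ∞) c0 V ∧ ContDiffOn ℝ (⊤ : ℕ∞) c1 V ∧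
        (∀ x ∈ V, a x ≠ 0) ∧ (∀ x ∈ V, b x ≠ 0) ∧
        LocEquivConic
          (fun x v => g11 x * v.1 ^ 2 + 2 * g12 x * v.1 * v.2 + g22 x * v.2 ^ 2
            + 2 * (ω1 x * v.1 + ω2 x * v.2) + h x)
          (fun x v => (a x) ^ 2 * (v.1 - c0 x) ^ 2 + ε * ((b x) ^ 2 * (v.2 - c1 x) ^ 2) - 1)
          x₀ V := by
  have hD1s : ContDiff ℝ (⊤ : ℕ∞) D1 := by rw [hD1]; fun_prop
  have hD2s : ContDiff ℝ (⊤ : ℕ∞) D2 := by rw [hD2]; fun_prop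
  let m11 : ℝ × ℝ → ℝ := fun x => g11 x * u1 ^ 2 + 2 * g12 x * u1 * u2 + g22 x * u2 ^ 2
  let m12 : ℝ × ℝ → ℝ := fun x => -g11 x * u1 * u2 + g12 x * (u1 ^ 2 - u2 ^ 2) + g22 x * u1 * u2
  have hm11s : ContDiff ℝ (⊤ : ℕ∞) m11 := by fun_prop
  have hm12s : ContDiff ℝ (⊤ : ℕ∞) m12 := by fun_prop
  have hm0 : m11 x₀ ≠ 0 := fun h0 => by
    simp only [m11] at h0
    rw [h0] at hu; simp at hu
  have hu0 : u1 ^ 2 + u2 ^ 2 ≠ 0 := fun h0 => by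
    have h1 : u1 = 0 := by nlinarith [sq_nonneg u1, sq_nonneg u2]
    have h2 : u2 = 0 := by nlinarith [sq_nonneg u1, sq_nonneg u2]
    apply hm0; simp [m11, h1, h2]
  let A : ℝ × ℝ → ℝ × ℝ := fun y =>
    (x₀.1 + (u1 * y.1 - u2 * y.2), x₀.2 + (u2 * y.1 + u1 * y.2))
  have hA : ContDiff ℝ (⊤ : ℕ∞) A := by fun_prop
  have hA0 : A 0 = x₀ := by simp [A]
  have hmA : ContDiff ℝ (⊤ : ℕ∞) fun y => m11 (A y) := hm11s.comp hA
  have hmA2 : ContDiff ℝ (⊤ : ℕ∞) fun y => m12 (A y) := hm12s.comp hA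
  have hO : IsOpen {y | m11 (A y) ≠ 0} := isOpen_ne_fun hmA.continuous continuous_const
  obtain ⟨r, hr, hrO⟩ := Metric.isOpen_iff.1 hO 0 (by rw [mem_ofPred_eq, hA0]; exact hm0)
  let χ : ContDiffBump (0 : ℝ × ℝ) := ⟨r / 4, r / 2, by linarith, by linarith⟩
  let F : ℝ × ℝ → ℝ := fun y => χ y * (-(m12 (A y) / m11 (A y)))
  have hFcs : HasCompactSupport F := χ.hasCompactSupport.mul_right
  have hF : ContDiff ℝ (⊤ : ℕ∞) F := by
    rw [contDiff_iff_contDiffAt]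
    intro y
    by_cases hy : m11 (A y) ≠ 0
    · exact χ.contDiff.contDiffAt.mul (hmA2.contDiffAt.div hmA.contDiffAt hy).neg
    · have hy' : y ∉ tsupport χ := by
        rw [χ.tsupport_eq]
        intro hy2
        refine hy (hrO ?_)
        have h3 : dist y 0 ≤ r / 2 := hy2
        rw [Metric.mem_ball]; linarith
      have h4 : F =ᶠ[nhds y] fun _ => 0 := by
        filter_upwards [notMem_tsupport_iff_eventuallyEq.1 hy'] with z hz
        simp only [F, hz, Pi.zero_apply, zero_mul]
      exact contDiffAt_const.congr_of_eventuallyEq h4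
  obtain ⟨X, hX, hX0, E, hE, hEpos, hXd⟩ := exists_flow F hF hFcs
  let Y : ℝ × ℝ → ℝ × ℝ := fun p => (X p, p.2)
  have hY : ContDiff ℝ (⊤ : ℕ∞) Y := hX.prodMk contDiff_snd
  let ψ : ℝ × ℝ → ℝ × ℝ := fun p => A (Y p)
  have hψ : ContDiff ℝ (⊤ : ℕ∞) ψ := hA.comp hY
  have hY0 : Y 0 = 0 := by
    have := hX0 0
    simp only [Y, Prod.mk_eq_zero, Prod.snd_zero, and_true]
    exact this
  have hψ0 : ψ 0 = x₀ := by simp only [ψ, hY0, hA0]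
  have hψd : ∀ p w, fderiv ℝ ψ p w =
      (u1 * (E p * w.1 + F (X p, p.2) * w.2) - u2 * w.2,
        u2 * (E p * w.1 + F (X p, p.2) * w.2) + u1 * w.2) := by
    intro p w
    have h1 := (hX.differentiable (by norm_cast) p).hasFDerivAt
    have h2 : HasFDerivAt (fun p : ℝ × ℝ => p.2) (ContinuousLinearMap.snd ℝ ℝ ℝ) p :=
      hasFDerivAt_snd
    have h3 : HasFDerivAt ψ _ p :=
      (((h1.const_mul u1).sub (h2.const_mul u2)).const_add x₀.1).prodMk
      (((h1.const_mul u2).add (h2.const_mul u1)).const_add x₀.2)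
    rw [h3.fderiv]
    simp [hXd]
  have hbij : ∀ p, Function.Bijective (fderiv ℝ ψ p) := by
    intro p
    have hinj : Function.Injective (fderiv ℝ ψ p).toLinearMap := by
      rw [← LinearMap.ker_eq_bot, LinearMap.ker_eq_bot']
      intro w hw
      have hw' : fderiv ℝ ψ p w = 0 := hw
      rw [hψd, Prod.mk_eq_zero] at hw'
      obtain ⟨e1, e2⟩ := hw'
      generalize hη : E p * w.1 + F (X p, p.2) * w.2 = η at e1 e2
      have h1 : (u1 ^ 2 + u2 ^ 2) * η = 0 := by linear_combination u1 * e1 + u2 * e2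
      have h2 : (u1 ^ 2 + u2 ^ 2) * w.2 = 0 := by linear_combination u1 * e2 - u2 * e1
      have h3 : w.2 = 0 := (mul_eq_zero.1 h2).resolve_left hu0
      have h4 : η = 0 := (mul_eq_zero.1 h1).resolve_left hu0
      rw [h3, h4, mul_zero, add_zero] at hη
      have h5 : w.1 = 0 := (mul_eq_zero.1 hη).resolve_left (hEpos p).ne'
      exact Prod.ext h5 h3
    exact ⟨hinj, LinearMap.injective_iff_surjective.1 hinj⟩
  -- the open set
  have hD10 : D1 x₀ ≠ 0 := fun h0 => by rw [h0] at hu; simp at hu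
  let W : Set (ℝ × ℝ) := {p | 0 < ε * D2 (ψ p)} ∩ ({p | 0 < -(m11 (ψ p) * D2 (ψ p)) * D1 (ψ p)}
    ∩ Y ⁻¹' (Metric.ball 0 (r / 4)))
  have cψ : Continuous ψ := hψ.continuous
  have cD1 : Continuous D1 := hD1s.continuous
  have cD2 : Continuous D2 := hD2s.continuous
  have cm : Continuous m11 := hm11s.continuous
  have hW : IsOpen W := by
    refine (isOpen_lt continuous_const (by fun_prop)).inter
      ((isOpen_lt continuous_const (by fun_prop)).inter (Metric.isOpen_ball.preimage hY.continuous))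
  have h0W : (0 : ℝ × ℝ) ∈ W := by
    refine ⟨?_, ?_, ?_⟩
    · rw [mem_ofPred_eq, hψ0]; exact hεD
    · rw [mem_ofPred_eq, hψ0]
      have : -(m11 x₀ * D2 x₀) * D1 x₀ = -(m11 x₀ * D2 x₀ / D1 x₀) * (D1 x₀) ^ 2 := by
        field_simp
      rw [this]
      exact mul_pos hu (by positivity)
    · rw [mem_preimage, hY0]; exact Metric.mem_ball_self (by linarith)
  have W1 : ∀ p ∈ W, D1 (ψ p) ≠ 0 := fun p hp h0 => by
    have := hp.2.1; rw [mem_ofPred_eq, h0] at this; simp at this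
  have W2 : ∀ p ∈ W, D2 (ψ p) ≠ 0 := fun p hp h0 => by
    have := hp.1; rw [mem_ofPred_eq, h0] at this; simp at this
  have Wm : ∀ p ∈ W, m11 (ψ p) ≠ 0 := fun p hp h0 => by
    have := hp.2.1; rw [mem_ofPred_eq, h0] at this; simp at this
  have Wa : ∀ p ∈ W, 0 < -(m11 (ψ p) * D2 (ψ p) / D1 (ψ p)) := fun p hp => by
    have h1 := W1 p hp
    have : -(m11 (ψ p) * D2 (ψ p) / D1 (ψ p))
      = (-(m11 (ψ p) * D2 (ψ p)) * D1 (ψ p)) / (D1 (ψ p)) ^ 2 := by field_simp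
    rw [this]
    exact div_pos hp.2.1 (by positivity)
  let B : ℝ × ℝ → ℝ := fun p =>
    ε * -((u1 ^ 2 + u2 ^ 2) ^ 2 * D2 (ψ p) / m11 (ψ p) * D2 (ψ p) / D1 (ψ p))
  have Wb : ∀ p ∈ W, 0 < B p := fun p hp => by
    have h1 := W1 p hp
    have h2 := Wm p hp
    have : B p = (ε * D2 (ψ p)) * ((u1 ^ 2 + u2 ^ 2) ^ 2 / m11 (ψ p) ^ 2)
        * -(m11 (ψ p) * D2 (ψ p) / D1 (ψ p)) := by
      simp only [B]; field_simp
    rw [this]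
    exact mul_pos (mul_pos hp.1 (by positivity)) (Wa p hp)
  have s11 : ContDiffOn ℝ (⊤ : ℕ∞) (fun p => g11 (ψ p)) W := (hg11.comp hψ).contDiffOn
  have s12 : ContDiffOn ℝ (⊤ : ℕ∞) (fun p => g12 (ψ p)) W := (hg12.comp hψ).contDiffOn
  have s22 : ContDiffOn ℝ (⊤ : ℕ∞) (fun p => g22 (ψ p)) W := (hg22.comp hψ).contDiffOn
  have so1 : ContDiffOn ℝ (⊤ : ℕ∞) (fun p => ω1 (ψ p)) W := (hω1.comp hψ).contDiffOn
  have so2 : ContDiffOn ℝ (⊤ : ℕ∞) (fun p => ω2 (ψ p)) W := (hω2.comp hψ).contDiffOn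
  have sD1 : ContDiffOn ℝ (⊤ : ℕ∞) (fun p => D1 (ψ p)) W := (hD1s.comp hψ).contDiffOn
  have sD2 : ContDiffOn ℝ (⊤ : ℕ∞) (fun p => D2 (ψ p)) W := (hD2s.comp hψ).contDiffOn
  have sm11 : ContDiffOn ℝ (⊤ : ℕ∞) (fun p => m11 (ψ p)) W := (hm11s.comp hψ).contDiffOn
  have sm12 : ContDiffOn ℝ (⊤ : ℕ∞) (fun p => m12 (ψ p)) W := (hm12s.comp hψ).contDiffOn
  have sE : ContDiffOn ℝ (⊤ : ℕ∞) E W := hE.contDiffOn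
  let k1 : ℝ × ℝ → ℝ := fun p =>
    (g12 (ψ p) * ω2 (ψ p) - g22 (ψ p) * ω1 (ψ p)) / D2 (ψ p)
  let k2 : ℝ × ℝ → ℝ := fun p =>
    (g12 (ψ p) * ω1 (ψ p) - g11 (ψ p) * ω2 (ψ p)) / D2 (ψ p)
  have sk1 : ContDiffOn ℝ (⊤ : ℕ∞) k1 W := ((s12.mul so2).sub (s22.mul so1)).div sD2 W2
  have sk2 : ContDiffOn ℝ (⊤ : ℕ∞) k2 W := ((s12.mul so1).sub (s11.mul so2)).div sD2 W2
  let t1 : ℝ × ℝ → ℝ := fun p => (u1 * k1 p + u2 * k2 p) / (u1 ^ 2 + u2 ^ 2)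
  let t2 : ℝ × ℝ → ℝ := fun p => (-u2 * k1 p + u1 * k2 p) / (u1 ^ 2 + u2 ^ 2)
  have st1 : ContDiffOn ℝ (⊤ : ℕ∞) t1 W :=
    ((contDiffOn_const.mul sk1).add (contDiffOn_const.mul sk2)).div_const _
  have st2 : ContDiffOn ℝ (⊤ : ℕ∞) t2 W :=
    ((contDiffOn_const.mul sk1).add (contDiffOn_const.mul sk2)).div_const _
  let f : ℝ × ℝ → ℝ := fun p => m12 (ψ p) / m11 (ψ p)
  have sf : ContDiffOn ℝ (⊤ : ℕ∞) f W := sm12.div sm11 Wm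
  have hFf : ∀ p ∈ W, F (X p, p.2) = -f p := by
    intro p hp
    have h1 : χ (Y p) = 1 := χ.one_of_mem_closedBall (Metric.ball_subset_closedBall hp.2.2)
    change χ (Y p) * (-(m12 (A (Y p)) / m11 (A (Y p)))) = _
    rw [h1, one_mul]
  have sB : ContDiffOn ℝ (⊤ : ℕ∞) B W :=
    contDiffOn_const.mul (((((contDiffOn_const.mul sD2).div sm11 Wm).mul sD2).div sD1 W1).neg)
  refine ⟨fun p => Real.sqrt (-(m11 (ψ p) * D2 (ψ p) / D1 (ψ p))) * E p,
    fun p => Real.sqrt (B p), fun p => (t1 p + f p * t2 p) / E p, t2, W, hW, ?_, ?_, ?_, st2,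
    ?_, ?_, ?_⟩
  · exact (((sm11.mul sD2).div sD1 W1).neg.sqrt fun p hp => (Wa p hp).ne').mul sE
  · exact sB.sqrt fun p hp => (Wb p hp).ne'
  · exact (st1.add (sf.mul st2)).div sE fun p _ => (hEpos p).ne'
  · exact fun p hp => mul_ne_zero (Real.sqrt_pos.2 (Wa p hp)).ne' (hEpos p).ne'
  · exact fun p hp => (Real.sqrt_pos.2 (Wb p hp)).ne'
  · refine locEquiv_of_pullback _ _ x₀ 0 W hW h0W ψ hψ hψ0 hbij
      (fun p => -(D2 (ψ p) / D1 (ψ p))) (sD2.div sD1 W1).neg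
      (fun p hp => neg_ne_zero.2 (div_ne_zero (W2 p hp) (W1 p hp))) ?_
    intro p hp w
    refine conic_alg (g11 (ψ p)) (g12 (ψ p)) (g22 (ψ p)) (ω1 (ψ p)) (ω2 (ψ p)) (h (ψ p)) u1 u2
      (D1 (ψ p)) (D2 (ψ p)) (m11 (ψ p)) (m12 (ψ p)) (E p) (f p) _ _ _ _ (t1 p) (t2 p) w.1 w.2 ε
      (by rw [hD2]) (by rw [hD1]) (W2 p hp) (W1 p hp) (hEpos p).ne' rfl rfl (Wm p hp) hu0 rfl
      ?_ ?_ rfl rfl rfl rfl _ _ ?_ ?_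
    · rw [mul_pow, Real.sq_sqrt (Wa p hp).le]
    · rw [Real.sq_sqrt (Wb p hp).le]
      simp only [B]
      rw [← mul_assoc, hε, one_mul]
    · rw [hψd, hFf p hp]; ring
    · rw [hψd, hFf p hp]; ring

/-- a nonempty conic submanifold
`S_q(x,ẋ) = ẋᵀ g(x) ẋ + 2 ω(x) ẋ + h(x) = 0` with `Δ₁(x₀) ≠ 0` is, locally around `x₀`,
equivalent to the elliptic form `{a²(ż−c₀)² + b²(ẏ−c₁)² = 1}` when `Δ₂(x₀) > 0`, and to the
hyperbolic form `{a²(ż−c₀)² − b²(ẏ−c₁)² = 1}` when `Δ₂(x₀) < 0`, with `a, b, c₀, c₁` smooth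
and `a`, `b` nonvanishing. -/
theorem stmt_1 (g11 g12 g22 ω1 ω2 h : (ℝ × ℝ) → ℝ) (x₀ : ℝ × ℝ)
    (hg11 : ContDiff ℝ (⊤ : ℕ∞) g11) (hg12 : ContDiff ℝ (⊤ : ℕ∞) g12) (hg22 : ContDiff ℝ (⊤ : ℕ∞) g22)
    (hω1 : ContDiff ℝ (⊤ : ℕ∞) ω1) (hω2 : ContDiff ℝ (⊤ : ℕ∞) ω2) (hh : ContDiff ℝ (⊤ : ℕ∞) h)
    -- the conic is nonempty near `x₀`
    (hne : ∃ U : Set (ℝ × ℝ), IsOpen U ∧ x₀ ∈ U ∧ ∀ x ∈ U, ∃ v : ℝ × ℝ,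
      g11 x * v.1 ^ 2 + 2 * g12 x * v.1 * v.2 + g22 x * v.2 ^ 2
        + 2 * (ω1 x * v.1 + ω2 x * v.2) + h x = 0)
    -- `Δ₁(x₀) ≠ 0`
    (hΔ1 : g11 x₀ * (g22 x₀ * h x₀ - ω2 x₀ ^ 2) - g12 x₀ * (g12 x₀ * h x₀ - ω1 x₀ * ω2 x₀)
        + ω1 x₀ * (g12 x₀ * ω2 x₀ - g22 x₀ * ω1 x₀) ≠ 0) :
    -- elliptic case
    (0 < g11 x₀ * g22 x₀ - g12 x₀ ^ 2 →
      ∃ (a b c0 c1 : (ℝ × ℝ) → ℝ) (V : Set (ℝ × ℝ)), IsOpen V ∧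
        ContDiffOn ℝ (⊤ : ℕ∞) a V ∧ ContDiffOn ℝ (⊤ : ℕ∞) b V ∧
        ContDiffOn ℝ (⊤ : ℕ∞) c0 V ∧ ContDiffOn ℝ (⊤ : ℕ∞) c1 V ∧
        (∀ x ∈ V, a x ≠ 0) ∧ (∀ x ∈ V, b x ≠ 0) ∧
        LocEquivConic
          (fun x v => g11 x * v.1 ^ 2 + 2 * g12 x * v.1 * v.2 + g22 x * v.2 ^ 2
            + 2 * (ω1 x * v.1 + ω2 x * v.2) + h x)
          (fun x v => (a x) ^ 2 * (v.1 - c0 x) ^ 2 + (b x) ^ 2 * (v.2 - c1 x) ^ 2 - 1)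
          x₀ V) ∧
    -- hyperbolic case
    (g11 x₀ * g22 x₀ - g12 x₀ ^ 2 < 0 →
      ∃ (a b c0 c1 : (ℝ × ℝ) → ℝ) (V : Set (ℝ × ℝ)), IsOpen V ∧
        ContDiffOn ℝ (⊤ : ℕ∞) a V ∧ ContDiffOn ℝ (⊤ : ℕ∞) b V ∧
        ContDiffOn ℝ (⊤ : ℕ∞) c0 V ∧ ContDiffOn ℝ (⊤ : ℕ∞) c1 V ∧
        (∀ x ∈ V, a x ≠ 0) ∧ (∀ x ∈ V, b x ≠ 0) ∧
        LocEquivConic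
          (fun x v => g11 x * v.1 ^ 2 + 2 * g12 x * v.1 * v.2 + g22 x * v.2 ^ 2
            + 2 * (ω1 x * v.1 + ω2 x * v.2) + h x)
          (fun x v => (a x) ^ 2 * (v.1 - c0 x) ^ 2 - (b x) ^ 2 * (v.2 - c1 x) ^ 2 - 1)
          x₀ V) := by
  have hD1 := hΔ1
  constructor
  · intro hD2
    obtain ⟨U, -, hxU, hU⟩ := hne
    obtain ⟨v, hv⟩ := hU x₀ hxU
    have key := conic_main g11 g12 g22 ω1 ω2 h x₀ hg11 hg12 hg22 hω1 hω2 hh _ _ rfl rfl 1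
      (by norm_num) (by simpa using hD2) 1 0 ?_
    · simpa only [one_mul] using key
    · generalize hk : g11 x₀ * (g22 x₀ * h x₀ - ω2 x₀ ^ 2)
        - g12 x₀ * (g12 x₀ * h x₀ - ω1 x₀ * ω2 x₀)
        + ω1 x₀ * (g12 x₀ * ω2 x₀ - g22 x₀ * ω1 x₀) = D1 at *
      generalize hd : g11 x₀ * g22 x₀ - g12 x₀ ^ 2 = D2 at *
      have hg0 : g11 x₀ ≠ 0 := fun h0 => by
        rw [h0] at hd; nlinarith [sq_nonneg (g12 x₀)]
      -- twice completed square
      have hsq : -(g11 x₀ * D1) * D2 =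
          (D2 * (g11 x₀ * v.1 + g12 x₀ * v.2 + ω1 x₀)) ^ 2
          + D2 * (D2 * v.2 - (g12 x₀ * ω1 x₀ - g11 x₀ * ω2 x₀)) ^ 2 := by
        rw [← hk, ← hd]
        linear_combination (-((g11 x₀ * g22 x₀ - g12 x₀ ^ 2) ^ 2 * g11 x₀)) * hv
      have h1 : 0 ≤ -(g11 x₀ * D1) * D2 := by rw [hsq]; positivity
      have h2 : -(g11 x₀ * D1) * D2 ≠ 0 :=
        mul_ne_zero (neg_ne_zero.2 (mul_ne_zero hg0 hD1)) hD2.ne'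
      have h3 : 0 < -(g11 x₀ * D1) * D2 := lt_of_le_of_ne h1 h2.symm
      have : -((g11 x₀ * 1 ^ 2 + 2 * g12 x₀ * 1 * 0 + g22 x₀ * 0 ^ 2) * D2 / D1)
          = (-(g11 x₀ * D1) * D2) / D1 ^ 2 := by field_simp; ring
      rw [this]
      positivity
  · intro hD2
    have hu : ∃ u1 u2 : ℝ, 0 < (g11 x₀ * u1 ^ 2 + 2 * g12 x₀ * u1 * u2 + g22 x₀ * u2 ^ 2) *
        (g11 x₀ * (g22 x₀ * h x₀ - ω2 x₀ ^ 2)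
        - g12 x₀ * (g12 x₀ * h x₀ - ω1 x₀ * ω2 x₀)
        + ω1 x₀ * (g12 x₀ * ω2 x₀ - g22 x₀ * ω1 x₀)) := by
      generalize g11 x₀ * (g22 x₀ * h x₀ - ω2 x₀ ^ 2)
        - g12 x₀ * (g12 x₀ * h x₀ - ω1 x₀ * ω2 x₀)
        + ω1 x₀ * (g12 x₀ * ω2 x₀ - g22 x₀ * ω1 x₀) = D1 at *
      by_cases h0 : g11 x₀ = 0
      · have h12 : g12 x₀ ≠ 0 := fun h' => by rw [h0, h'] at hD2; simp at hD2
        refine ⟨(D1 - g22 x₀) / (2 * g12 x₀), 1, ?_⟩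
        have : (g11 x₀ * ((D1 - g22 x₀) / (2 * g12 x₀)) ^ 2
          + 2 * g12 x₀ * ((D1 - g22 x₀) / (2 * g12 x₀)) * 1 + g22 x₀ * 1 ^ 2) * D1 = D1 ^ 2 := by
          rw [h0]; field_simp; ring
        rw [this]; positivity
      · rcases lt_or_gt_of_ne (mul_ne_zero h0 hD1) with hlt | hgt
        · refine ⟨-g12 x₀, g11 x₀, ?_⟩
          have := mul_pos_of_neg_of_neg hlt hD2
          linarith
        · exact ⟨1, 0, by linarith⟩
    obtain ⟨u1, u2, hu⟩ := hu
    have key := conic_main g11 g12 g22 ω1 ω2 h x₀ hg11 hg12 hg22 hω1 hω2 hh _ _ rfl rfl (-1)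
      (by norm_num) (by linarith) u1 u2 ?_
    · simpa only [neg_one_mul, ← sub_eq_add_neg] using key
    · generalize g11 x₀ * (g22 x₀ * h x₀ - ω2 x₀ ^ 2)
        - g12 x₀ * (g12 x₀ * h x₀ - ω1 x₀ * ω2 x₀)
        + ω1 x₀ * (g12 x₀ * ω2 x₀ - g22 x₀ * ω1 x₀) = D1 at *
      generalize g11 x₀ * u1 ^ 2 + 2 * g12 x₀ * u1 * u2 + g22 x₀ * u2 ^ 2 = q at *
      generalize g11 x₀ * g22 x₀ - g12 x₀ ^ 2 = D2 at *
      have : -(q * D2 / D1) = (q * D1) * (-D2) / D1 ^ 2 := by field_simp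
      rw [this]
      exact div_pos (mul_pos hu (neg_pos.2 hD2)) (by positivity)
end
end

section
/- Let S_q(x,ẋ) = ẋᵀg(x)ẋ + 2ω(x)ẋ + h(x) define a conic submanifold of Tℝ² which is nonempty near x₀ and satisfies Δ₁(x₀) ≠ 0. If Δ₂ ≡ 0 on a neighbourhood of x₀, then, locally around x₀, {S_q=0} is equivalent to the parabolic submanifold {a·ẏ² − ż + b·ẏ + c = 0} for some smooth functions a, b, c of x=(z,y) with a nonvanishing. -/
noncomputable section

open Set

open scoped Topology ContDiff

/-- Post-composition with a continuous map, on the Banach space of continuous curves. -/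
def nemy {E F : Type} [NormedAddCommGroup E] [NormedAddCommGroup F] (W : E → F)
    (hW : Continuous W) (γ : C(unitInterval, E)) : C(unitInterval, F) :=
  (⟨W, hW⟩ : C(E, F)).comp γ

/-- Pointwise application of a curve of linear maps to a curve of vectors. -/
def appCLM (E F : Type) [NormedAddCommGroup E] [NormedAddCommGroup F]
    [NormedSpace ℝ E] [NormedSpace ℝ F] :
    C(unitInterval, E →L[ℝ] F) →L[ℝ] C(unitInterval, E) →L[ℝ] C(unitInterval, F) :=
  LinearMap.mkContinuous₂
    (LinearMap.mk₂ ℝ (fun (A : C(unitInterval, E →L[ℝ] F)) (γ : C(unitInterval, E)) =>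
      (⟨fun t => A t (γ t), by fun_prop⟩ : C(unitInterval, F)))
      (by intros; ext; simp) (by intros; ext; simp) (by intros; ext; simp) (by intros; ext; simp))
    1 (by
      intro A γ
      rw [ContinuousMap.norm_le _ (by positivity)]
      intro t
      simp only [LinearMap.mk₂_apply, ContinuousMap.coe_mk, one_mul]
      exact (A t).le_of_opNorm_le_of_le (A.norm_coe_le_norm t) (γ.norm_coe_le_norm t))

theorem appCLM_apply {E F : Type} [NormedAddCommGroup E] [NormedAddCommGroup F]
    [NormedSpace ℝ E] [NormedSpace ℝ F] (A : C(unitInterval, E →L[ℝ] F)) (γ : C(unitInterval, E))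
    (t : unitInterval) : appCLM E F A γ t = A t (γ t) := rfl

theorem nemy_continuous {E F : Type} [NormedAddCommGroup E] [NormedAddCommGroup F] (W : E → F)
    (hW : Continuous W) : Continuous (nemy W hW) :=
  ContinuousMap.continuous_postcomp (X := unitInterval) (⟨W, hW⟩ : C(E, F))

theorem nemy_hasFDerivAt {E F : Type} [NormedAddCommGroup E] [NormedAddCommGroup F]
    [NormedSpace ℝ E] [NormedSpace ℝ F] (W : E → F) (hW : Continuous W)
    (W' : E → E →L[ℝ] F) (hW' : Continuous W') (hd : ∀ x, HasFDerivAt W (W' x) x)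
    (γ : C(unitInterval, E)) :
    HasFDerivAt (nemy W hW) (appCLM E F (nemy W' hW' γ)) γ := by
  rw [hasFDerivAt_iff_isLittleO_nhds_zero, Asymptotics.isLittleO_iff]
  intro ε hε
  have hc := Metric.continuous_iff.1 (nemy_continuous W' hW') γ ε hε
  obtain ⟨d, hd0, hc⟩ := hc
  filter_upwards [Metric.ball_mem_nhds (0 : C(unitInterval, E)) hd0] with η hη
  rw [ContinuousMap.norm_le _ (by positivity)]
  intro t
  have hb : ∀ z ∈ Metric.ball (γ t) d, ‖W' z - W' (γ t)‖ ≤ ε := by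
    intro z hz
    have h1 := hc (γ + ContinuousMap.const _ (z - γ t)) (by
      rw [dist_eq_norm, add_sub_cancel_left]
      refine lt_of_le_of_lt ((ContinuousMap.norm_le _ (norm_nonneg (z - γ t))).2 ?_)
        (mem_ball_iff_norm.1 hz)
      intro s; simp)
    have h2 := (ContinuousMap.dist_apply_le_dist t).trans h1.le
    simpa [nemy, dist_eq_norm] using h2
  have hηt : ‖η t‖ ≤ ‖η‖ := η.norm_coe_le_norm t
  have h3 := Convex.norm_image_sub_le_of_norm_hasFDerivWithin_le' (f := W) (f' := W')
    (φ := W' (γ t)) (s := Metric.ball (γ t) d) (C := ε) (x := γ t) (y := γ t + η t)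
    (fun z _ => (hd z).hasFDerivWithinAt) hb (convex_ball _ _) (Metric.mem_ball_self hd0)
    (by
      rw [mem_ball_iff_norm, add_sub_cancel_left]
      exact lt_of_le_of_lt hηt (by simpa using hη))
  rw [add_sub_cancel_left] at h3
  have h4 : ε * ‖η t‖ ≤ ε * ‖η‖ := by gcongr
  exact h3.trans h4

theorem appCLM_contDiff (E F : Type) [NormedAddCommGroup E] [NormedAddCommGroup F]
    [NormedSpace ℝ E] [NormedSpace ℝ F] (n : WithTop ℕ∞) :
    ContDiff ℝ n (fun A : C(unitInterval, E →L[ℝ] F) => appCLM E F A) :=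
  ContinuousLinearMap.contDiff (𝕜 := ℝ) (E := C(unitInterval, E →L[ℝ] F))
    (F := C(unitInterval, E) →L[ℝ] C(unitInterval, F)) (appCLM E F)

theorem nemy_contDiff_nat {E : Type} [NormedAddCommGroup E] [NormedSpace ℝ E] (n : ℕ) :
    ∀ {F : Type} [NormedAddCommGroup F] [NormedSpace ℝ F] (W : E → F) (hW : Continuous W),
      ContDiff ℝ n W → ContDiff ℝ n (nemy W hW) := by
  induction n with
  | zero =>
    intro F _ _ W hW _
    exact contDiff_zero.2 (nemy_continuous W hW)
  | succ n ih =>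
    intro F _ _ W hW h
    push_cast at h ⊢
    obtain ⟨W', h1, h2⟩ := contDiff_succ_iff_hasFDerivAt.1 h
    exact contDiff_succ_iff_hasFDerivAt.2 ⟨fun γ => appCLM E F (nemy W' h1.continuous γ),
      (appCLM_contDiff E F n).comp (ih W' h1.continuous h1),
      fun γ => nemy_hasFDerivAt W hW W' h1.continuous h2 γ⟩

theorem nemy_contDiff {E F : Type} [NormedAddCommGroup E] [NormedSpace ℝ E]
    [NormedAddCommGroup F] [NormedSpace ℝ F] (W : E → F) (hW : ContDiff ℝ (⊤ : ℕ∞) W) :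
    ContDiff ℝ (⊤ : ℕ∞) (nemy W hW.continuous) :=
  contDiff_infty.2 fun n => nemy_contDiff_nat n W _ (contDiff_infty.1 hW n)

/-- Primitive vanishing at `0`, as a continuous linear operator on curves. -/
def primCLM (E : Type) [NormedAddCommGroup E] [NormedSpace ℝ E] [CompleteSpace E] :
    C(unitInterval, E) →L[ℝ] C(unitInterval, E) :=
  LinearMap.mkContinuous
    { toFun := fun γ => ⟨fun t => ∫ u in (0:ℝ)..t, γ (projIcc 0 1 zero_le_one u), by
        have h : Continuous fun u : ℝ => γ (projIcc 0 1 zero_le_one u) := by fun_prop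
        exact (intervalIntegral.continuous_primitive
          (fun a b => h.intervalIntegrable a b) 0).comp continuous_subtype_val⟩
      map_add' := by
        intro γ η
        ext t
        have h : Continuous fun u : ℝ => γ (projIcc 0 1 zero_le_one u) := by fun_prop
        have h' : Continuous fun u : ℝ => η (projIcc 0 1 zero_le_one u) := by fun_prop
        simpa using intervalIntegral.integral_add (h.intervalIntegrable 0 (t : ℝ))
          (h'.intervalIntegrable _ _)
      map_smul' := by
        intro c γ
        ext t
        simp }
    1 (by
      intro γ
      rw [ContinuousMap.norm_le _ (by positivity)]
      intro t
      have h := intervalIntegral.norm_integral_le_of_norm_le_const (a := (0:ℝ)) (b := t)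
        (f := fun u : ℝ => γ (projIcc 0 1 zero_le_one u)) (C := ‖γ‖)
        (fun u _ => γ.norm_coe_le_norm _)
      refine h.trans ?_
      rw [one_mul, sub_zero, abs_of_nonneg t.2.1]
      exact mul_le_of_le_one_right (norm_nonneg _) t.2.2)

theorem primCLM_apply {E : Type} [NormedAddCommGroup E] [NormedSpace ℝ E] [CompleteSpace E]
    (γ : C(unitInterval, E)) (t : unitInterval) :
    primCLM E γ t = ∫ u in (0:ℝ)..t, γ (projIcc 0 1 zero_le_one u) := rfl

/-- Inverse function theorem, smooth on a whole neighbourhood. -/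
theorem smooth_local_inverse {X Y : Type} [NormedAddCommGroup X] [NormedSpace ℝ X]
    [NormedAddCommGroup Y] [NormedSpace ℝ Y] [CompleteSpace X] (Φ : X → Y) (O : Set X)
    (hO : IsOpen O) (hΦ : ContDiffOn ℝ (⊤ : ℕ∞) Φ O) (a : X) (ha : a ∈ O) (e : X ≃L[ℝ] Y)
    (he : HasFDerivAt Φ (e : X →L[ℝ] Y) a) :
    ∃ R : OpenPartialHomeomorph X Y, (∀ x, R x = Φ x) ∧ a ∈ R.source ∧ R.source ⊆ O ∧
      (∀ x ∈ R.source, ∃ e : X ≃L[ℝ] Y, HasFDerivAt Φ (e : X →L[ℝ] Y) x) ∧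
      ContDiffOn ℝ (⊤ : ℕ∞) R.symm R.target := by
  have hat : ∀ x ∈ O, ContDiffAt ℝ (⊤ : ℕ∞) Φ x := fun x hx => hΦ.contDiffAt (hO.mem_nhds hx)
  have hn : ((⊤ : ℕ∞) : WithTop ℕ∞) ≠ 0 := by simp
  have hcont : ContinuousOn (fderiv ℝ Φ) O :=
    hΦ.continuousOn_fderiv_of_isOpen hO (by exact_mod_cast le_top)
  set O' := O ∩ fderiv ℝ Φ ⁻¹' (range ((↑) : (X ≃L[ℝ] Y) → X →L[ℝ] Y)) with hO'
  have hO'o : IsOpen O' := hcont.isOpen_inter_preimage hO ContinuousLinearEquiv.isOpen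
  let R0 := (hat a ha).toOpenPartialHomeomorph Φ he hn
  have hder : ∀ x ∈ O', ∃ e : X ≃L[ℝ] Y, HasFDerivAt Φ (e : X →L[ℝ] Y) x := by
    rintro x ⟨hx, e, hex⟩
    exact ⟨e, hex ▸ ((hat x hx).differentiableAt hn).hasFDerivAt⟩
  have hs : (R0.restrOpen O' hO'o).source = R0.source ∩ O' := R0.restrOpen_source O' hO'o
  refine ⟨R0.restrOpen O' hO'o, fun x => rfl, ?_, ?_, ?_, ?_⟩
  · rw [hs]
    exact ⟨(hat a ha).mem_toOpenPartialHomeomorph_source he hn, ha, e, he.fderiv.symm⟩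
  · rw [hs]; exact fun x hx => hx.2.1
  · rw [hs]; exact fun x hx => hder x hx.2
  · intro y hy
    have hy' := (R0.restrOpen O' hO'o).map_target hy
    rw [hs] at hy'
    obtain ⟨e', he'⟩ := hder _ hy'.2
    exact ((R0.restrOpen O' hO'o).contDiffAt_symm hy he' (hat _ hy'.2.1)).contDiffWithinAt

/-- The Picard map with rescaled time. -/
def picMap {E : Type} [NormedAddCommGroup E] [NormedSpace ℝ E] [CompleteSpace E]
    (W : E → E) (hW : ContDiff ℝ (⊤ : ℕ∞) W) (x₀ T : E)
    (q : (ℝ × ℝ) × C(unitInterval, E)) : (ℝ × ℝ) × C(unitInterval, E) :=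
  (q.1, q.2 - (ContinuousMap.const _ x₀ + q.1.2 • ContinuousMap.const _ T)
    - q.1.1 • primCLM E (nemy W hW.continuous q.2))

theorem prim_nemy_contDiff {E : Type} [NormedAddCommGroup E] [NormedSpace ℝ E] [CompleteSpace E]
    (W : E → E) (hW : ContDiff ℝ (⊤ : ℕ∞) W) :
    ContDiff ℝ (⊤ : ℕ∞) (fun q : (ℝ × ℝ) × C(unitInterval, E) =>
      primCLM E (nemy W hW.continuous q.2)) := by
  have h : ContDiff ℝ (⊤ : ℕ∞) (fun γ : C(unitInterval, E) => primCLM E γ) :=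
    ContinuousLinearMap.contDiff (𝕜 := ℝ) (E := C(unitInterval, E))
      (F := C(unitInterval, E)) (primCLM E)
  exact h.comp ((nemy_contDiff W hW).comp contDiff_snd)

theorem picMap_contDiff {E : Type} [NormedAddCommGroup E] [NormedSpace ℝ E] [CompleteSpace E]
    (W : E → E) (hW : ContDiff ℝ (⊤ : ℕ∞) W) (x₀ T : E) :
    ContDiff ℝ (⊤ : ℕ∞) (picMap W hW x₀ T) := by
  have h := prim_nemy_contDiff W hW
  unfold picMap
  refine contDiff_fst.prodMk ((contDiff_snd.sub (contDiff_const.add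
    ((contDiff_snd.comp contDiff_fst).smul contDiff_const))).sub
    ((contDiff_fst.comp contDiff_fst).smul h))

/-- A triangular linear automorphism. -/
def triEquiv {Z : Type} [NormedAddCommGroup Z] [NormedSpace ℝ Z] (L : (ℝ × ℝ) →L[ℝ] Z) :
    ((ℝ × ℝ) × Z) ≃L[ℝ] ((ℝ × ℝ) × Z) :=
  ContinuousLinearEquiv.equivOfInverse
    ((ContinuousLinearMap.fst ℝ (ℝ × ℝ) Z).prod
      (ContinuousLinearMap.snd ℝ (ℝ × ℝ) Z - L.comp (ContinuousLinearMap.fst ℝ (ℝ × ℝ) Z)))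
    ((ContinuousLinearMap.fst ℝ (ℝ × ℝ) Z).prod
      (ContinuousLinearMap.snd ℝ (ℝ × ℝ) Z + L.comp (ContinuousLinearMap.fst ℝ (ℝ × ℝ) Z)))
    (by intro q; ext1 <;> simp) (by intro q; ext1 <;> simp)

theorem picMap_hasFDerivAt {E : Type} [NormedAddCommGroup E] [NormedSpace ℝ E] [CompleteSpace E]
    (W : E → E) (hW : ContDiff ℝ (⊤ : ℕ∞) W) (x₀ T : E) (γ₀ : C(unitInterval, E)) :
    ∃ e : ((ℝ × ℝ) × C(unitInterval, E)) ≃L[ℝ] ((ℝ × ℝ) × C(unitInterval, E)),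
      HasFDerivAt (picMap W hW x₀ T)
        (e : ((ℝ × ℝ) × C(unitInterval, E)) →L[ℝ] ((ℝ × ℝ) × C(unitInterval, E)))
        ((0, 0), γ₀) := by
  have h := ((prim_nemy_contDiff W hW).differentiable (by simp)
    ((0, 0), γ₀)).hasFDerivAt
  have h1 : HasFDerivAt (fun q : (ℝ × ℝ) × C(unitInterval, E) => q.1.1)
      ((ContinuousLinearMap.fst ℝ ℝ ℝ).comp
        (ContinuousLinearMap.fst ℝ (ℝ × ℝ) C(unitInterval, E))) ((0, 0), γ₀) :=
    ContinuousLinearMap.hasFDerivAt ((ContinuousLinearMap.fst ℝ ℝ ℝ).comp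
        (ContinuousLinearMap.fst ℝ (ℝ × ℝ) C(unitInterval, E)))
  have h2 : HasFDerivAt (fun q : (ℝ × ℝ) × C(unitInterval, E) => q.1.2)
      ((ContinuousLinearMap.snd ℝ ℝ ℝ).comp
        (ContinuousLinearMap.fst ℝ (ℝ × ℝ) C(unitInterval, E))) ((0, 0), γ₀) :=
    ContinuousLinearMap.hasFDerivAt ((ContinuousLinearMap.snd ℝ ℝ ℝ).comp
        (ContinuousLinearMap.fst ℝ (ℝ × ℝ) C(unitInterval, E)))
  have h3 := (hasFDerivAt_fst (𝕜 := ℝ) (p := (((0:ℝ), (0:ℝ)), γ₀))).prodMk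
    (((hasFDerivAt_snd (𝕜 := ℝ) (p := (((0:ℝ), (0:ℝ)), γ₀))).sub
      ((h2.smul_const (ContinuousMap.const unitInterval T)).const_add
        (ContinuousMap.const unitInterval x₀))).sub (h1.smul h))
  refine ⟨triEquiv ((ContinuousLinearMap.snd ℝ ℝ ℝ).smulRight (ContinuousMap.const _ T)
    + (ContinuousLinearMap.fst ℝ ℝ ℝ).smulRight (primCLM E (nemy W hW.continuous γ₀))), ?_⟩
  refine h3.congr_fderiv ?_
  refine ContinuousLinearMap.ext fun q => ?_
  refine Prod.ext ?_ ?_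
  · simp [triEquiv]
  · simp only [triEquiv]
    simp
    abel

theorem contDiff_eval_one {E : Type} [NormedAddCommGroup E] [NormedSpace ℝ E] (t : unitInterval) :
    ContDiff ℝ (⊤ : ℕ∞) (fun γ : C(unitInterval, E) => γ t) :=
  ContinuousLinearMap.contDiff (𝕜 := ℝ) (E := C(unitInterval, E)) (F := E)
    (ContinuousMap.evalCLM ℝ t)

theorem flow_box {E : Type} [NormedAddCommGroup E] [NormedSpace ℝ E] [CompleteSpace E]
    (W : E → E) (hW : ContDiff ℝ (⊤ : ℕ∞) W) (x₀ T : E) :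
    ∃ (ψ : ℝ × ℝ → E) (V : Set (ℝ × ℝ)), IsOpen V ∧ (0, 0) ∈ V ∧
      ContDiffOn ℝ (⊤ : ℕ∞) ψ V ∧ ψ (0, 0) = x₀ ∧
      (∀ p ∈ V, fderiv ℝ ψ p (1, 0) = W (ψ p)) ∧ fderiv ℝ ψ (0, 0) (0, 1) = T := by
  set γ₀ : C(unitInterval, E) := ContinuousMap.const _ x₀ with hγ₀
  set q₀ : (ℝ × ℝ) × C(unitInterval, E) := ((0, 0), γ₀) with hq₀
  obtain ⟨e, he⟩ := picMap_hasFDerivAt W hW x₀ T γ₀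
  obtain ⟨R, hR, hqs, -, -, hRs⟩ := smooth_local_inverse (picMap W hW x₀ T) univ isOpen_univ
    (picMap_contDiff W hW x₀ T).contDiffOn q₀ (mem_univ _) e he
  have hRq₀ : R q₀ = ((0, 0), 0) := by
    rw [hR]; simp [picMap, hq₀, hγ₀]
  obtain ⟨ε, hε, hball⟩ := Metric.isOpen_iff.1 R.open_source q₀ hqs
  have hO1 : IsOpen (R.target ∩ R.symm ⁻¹' Metric.ball q₀ ε) :=
    R.isOpen_inter_preimage_symm Metric.isOpen_ball
  have hO2 : IsOpen ((fun p : ℝ × ℝ => (p, (0 : C(unitInterval, E)))) ⁻¹'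
      (R.target ∩ R.symm ⁻¹' Metric.ball q₀ ε)) := hO1.preimage (by fun_prop)
  have h0 : ((0, 0) : ℝ × ℝ) ∈ ((fun p : ℝ × ℝ => (p, (0 : C(unitInterval, E)))) ⁻¹'
      (R.target ∩ R.symm ⁻¹' Metric.ball q₀ ε)) := by
    have h1 : ((0, 0), 0) ∈ R.target := hRq₀ ▸ R.map_source hqs
    refine ⟨h1, ?_⟩
    have h2 : R.symm ((0, 0), 0) = q₀ := by rw [← hRq₀]; exact R.left_inv hqs
    change R.symm ((0, 0), 0) ∈ Metric.ball q₀ ε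
    rw [h2]; exact Metric.mem_ball_self hε
  obtain ⟨r, hr, hV⟩ := Metric.isOpen_iff.1 hO2 _ h0
  set V := Metric.ball ((0, 0) : ℝ × ℝ) r with hVdef
  have hmemV : ∀ p : ℝ × ℝ, p ∈ V ↔ |p.1| < r ∧ |p.2| < r := by
    intro p
    simp [hVdef, Metric.mem_ball, Prod.dist_eq]
  set Γ : ℝ × ℝ → C(unitInterval, E) := fun p => (R.symm (p, 0)).2 with hΓ
  have hpic : ∀ p ∈ V, picMap W hW x₀ T (R.symm (p, 0)) = (p, 0) := by
    intro p hp
    rw [← hR]; exact R.right_inv (hV hp).1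
  have hfst : ∀ p ∈ V, R.symm (p, 0) = (p, Γ p) := by
    intro p hp
    have h1 : (R.symm (p, 0)).1 = p := congrArg Prod.fst (hpic p hp)
    exact Prod.ext h1 rfl
  have hint : ∀ p ∈ V, ∀ t : unitInterval, Γ p t = x₀ + p.2 • T
      + p.1 • ∫ u in (0:ℝ)..t, W (Γ p (projIcc 0 1 zero_le_one u)) := by
    intro p hp t
    have h1 := hpic p hp
    rw [hfst p hp] at h1
    have h2 := congrArg (fun f : C(unitInterval, E) => f t) (congrArg Prod.snd h1)
    have h3 : Γ p t - (x₀ + p.2 • T)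
      - p.1 • ∫ u in (0:ℝ)..t, W (Γ p (projIcc 0 1 zero_le_one u)) = 0 := h2
    rw [sub_sub] at h3
    exact sub_eq_zero.1 h3
  have hscale : ∀ p ∈ V, ∀ τ : unitInterval, (((τ : ℝ) * p.1, p.2) : ℝ × ℝ) ∈ V := by
    intro p hp τ
    rw [hmemV] at hp ⊢
    refine ⟨?_, hp.2⟩
    rw [abs_mul, abs_of_nonneg τ.2.1]
    exact lt_of_le_of_lt (mul_le_of_le_one_left (abs_nonneg _) τ.2.2) hp.1
  have hrep : ∀ p ∈ V, ∀ τ : unitInterval, Γ ((τ : ℝ) * p.1, p.2) 1 = Γ p τ := by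
    intro p hp τ
    let η : C(unitInterval, E) := ⟨fun t => Γ p (τ * t), by fun_prop⟩
    have hb := (hV hp).2
    change R.symm (p, 0) ∈ Metric.ball q₀ ε at hb
    rw [hfst p hp, Metric.mem_ball, Prod.dist_eq, max_lt_iff] at hb
    have hq : (((τ : ℝ) * p.1, p.2), η) ∈ Metric.ball q₀ ε := by
      rw [Metric.mem_ball, Prod.dist_eq, max_lt_iff]
      constructor
      · refine lt_of_le_of_lt ?_ hb.1
        simp only [hq₀, Prod.dist_eq, Real.dist_eq, sub_zero]
        refine max_le_max ?_ le_rfl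
        rw [abs_mul, abs_of_nonneg τ.2.1]
        exact mul_le_of_le_one_left (abs_nonneg _) τ.2.2
      · refine lt_of_le_of_lt ?_ hb.2
        rw [ContinuousMap.dist_le dist_nonneg]
        intro t
        exact ContinuousMap.dist_apply_le_dist (f := Γ p) (g := γ₀) (τ * t)
    have hpq : picMap W hW x₀ T (((τ : ℝ) * p.1, p.2), η) = (((τ : ℝ) * p.1, p.2), 0) := by
      refine Prod.ext rfl ?_
      ext t
      change Γ p (τ * t) - (x₀ + p.2 • T) - ((τ : ℝ) * p.1) •
        (∫ u in (0:ℝ)..t, W (Γ p (τ * projIcc 0 1 zero_le_one u))) = 0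
      rw [hint p hp (τ * t)]
      have h1 : (∫ u in (0:ℝ)..t, W (Γ p (τ * projIcc 0 1 zero_le_one u)))
          = ∫ u in (0:ℝ)..t, W (Γ p (projIcc 0 1 zero_le_one ((τ : ℝ) * u))) := by
        refine intervalIntegral.integral_congr ?_
        intro u hu
        rw [uIcc_of_le t.2.1] at hu
        have hu1 : u ∈ Icc (0:ℝ) 1 := ⟨hu.1, hu.2.trans t.2.2⟩
        have h2 : τ * projIcc 0 1 zero_le_one u
            = projIcc 0 1 zero_le_one ((τ : ℝ) * u) := by
          have h3 : (τ : ℝ) * u ∈ Icc (0:ℝ) 1 :=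
            ⟨mul_nonneg τ.2.1 hu1.1, mul_le_one₀ τ.2.2 hu1.1 hu1.2⟩
          rw [projIcc_of_mem _ hu1, projIcc_of_mem _ h3]
          rfl
        simp only [h2]
      have h4 := intervalIntegral.smul_integral_comp_mul_left (a := (0:ℝ)) (b := (t:ℝ))
        (f := fun u => W (Γ p (projIcc 0 1 zero_le_one u))) (c := (τ : ℝ))
      rw [h1, mul_comm (τ : ℝ) p.1, mul_smul, h4]
      simp
    have h5 := R.left_inv (hball hq)
    rw [hR, hpq, hfst _ (hscale p hp τ)] at h5
    have h6 := congrArg Prod.snd h5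
    change Γ ((τ : ℝ) * p.1, p.2) = η at h6
    rw [h6]
    change Γ p (τ * 1) = Γ p τ
    rw [mul_one]
  set ψ : ℝ × ℝ → E := fun p => Γ p 1 with hψ
  have hVo : IsOpen V := Metric.isOpen_ball
  have h0V : ((0, 0) : ℝ × ℝ) ∈ V := Metric.mem_ball_self hr
  have hsm : ContDiffOn ℝ (⊤ : ℕ∞) ψ V := by
    refine ((contDiff_eval_one (E := E) 1).comp contDiff_snd).comp_contDiffOn
      (hRs.comp (contDiff_id.prodMk contDiff_const).contDiffOn ?_)
    intro p hp
    exact (hV hp).1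
  have hdiff : ∀ p ∈ V, DifferentiableAt ℝ ψ p := fun p hp =>
    (hsm.contDiffAt (hVo.mem_nhds hp)).differentiableAt (by simp)
  have hzero : ∀ y : ℝ, ((0, y) : ℝ × ℝ) ∈ V → ψ (0, y) = x₀ + y • T := by
    intro y hy
    have := hint _ hy 1
    simpa using this
  refine ⟨ψ, V, hVo, h0V, hsm, ?_, ?_, ?_⟩
  · simpa using hzero 0 h0V
  · intro p hp
    obtain ⟨s, τ, hs, hτ, hsV⟩ : ∃ (s : ℝ) (τ : unitInterval), s ≠ 0 ∧ p.1 = τ * s ∧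
        ((s, p.2) : ℝ × ℝ) ∈ V := by
      by_cases h : p.1 = 0
      · refine ⟨r / 2, 0, by positivity, by simp [h], ?_⟩
        rw [hmemV] at hp ⊢
        refine ⟨?_, hp.2⟩
        simp only
        rw [abs_of_pos (by positivity)]
        linarith
      · exact ⟨p.1, 1, h, by simp, hp⟩
    have hp' : p = ((τ : ℝ) * s, p.2) := Prod.ext hτ rfl
    have hA : HasDerivWithinAt (fun u : ℝ => ψ (u * s, p.2)) (fderiv ℝ ψ p (s, 0))
        (Icc 0 1) (τ : ℝ) := by
      have h1 : HasDerivAt (fun u : ℝ => ((u * s, p.2) : ℝ × ℝ)) (s, 0) (τ : ℝ) := by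
        have := ((hasDerivAt_id (τ : ℝ)).mul_const s).prodMk (hasDerivAt_const (τ : ℝ) p.2)
        simpa using this
      have h2 : HasFDerivAt ψ (fderiv ℝ ψ p) ((τ : ℝ) * s, p.2) := by
        rw [← hp']; exact (hdiff p hp).hasFDerivAt
      exact (h2.comp_hasDerivAt (τ : ℝ) h1).hasDerivWithinAt
    have hB : HasDerivWithinAt (fun u : ℝ => ψ (u * s, p.2)) (s • W (ψ p))
        (Icc 0 1) (τ : ℝ) := by
      have hc : Continuous fun u : ℝ => W (Γ (s, p.2) (projIcc 0 1 zero_le_one u)) :=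
        hW.continuous.comp (by fun_prop)
      have h1 : HasDerivAt (fun v : ℝ => x₀ + p.2 • T + s • ∫ u in (0:ℝ)..v,
          W (Γ (s, p.2) (projIcc 0 1 zero_le_one u)))
          (s • W (Γ (s, p.2) (projIcc 0 1 zero_le_one (τ : ℝ)))) (τ : ℝ) :=
        ((hc.integral_hasStrictDerivAt 0 (τ : ℝ)).hasDerivAt.const_smul s).const_add _
      have h2 : W (Γ (s, p.2) (projIcc 0 1 zero_le_one (τ : ℝ))) = W (ψ p) := by
        rw [projIcc_val]
        have := hrep _ hsV τ
        rw [← this, ← hp']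
      rw [h2] at h1
      refine h1.hasDerivWithinAt.congr_of_mem ?_ τ.2
      intro u hu
      have h3 := hrep _ hsV ⟨u, hu⟩
      have h4 := hint _ hsV ⟨u, hu⟩
      exact h3.trans h4
    have hu : UniqueDiffWithinAt ℝ (Icc (0:ℝ) 1) (τ : ℝ) := uniqueDiffOn_Icc_zero_one _ τ.2
    have h5 := hu.eq_deriv _ hA hB
    have h6 : ((s, 0) : ℝ × ℝ) = s • ((1, 0) : ℝ × ℝ) := by simp
    rw [h6, map_smul] at h5
    exact smul_right_injective E hs h5
  · have h1 : HasDerivAt (fun y : ℝ => ((0, y) : ℝ × ℝ)) (0, 1) 0 :=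
      (hasDerivAt_const (0:ℝ) (0:ℝ)).prodMk (hasDerivAt_id (0:ℝ))
    have h2 := (hdiff _ h0V).hasFDerivAt.comp_hasDerivAt (0:ℝ) h1
    have h3 : HasDerivAt (fun y : ℝ => x₀ + y • T) T 0 := by
      simpa using ((hasDerivAt_id (0:ℝ)).smul_const T).const_add x₀
    have h4 : (fun y : ℝ => x₀ + y • T) =ᶠ[𝓝 0] (ψ ∘ fun y : ℝ => ((0, y) : ℝ × ℝ)) := by
      have hcy : ContinuousAt (fun y : ℝ => ((0, y) : ℝ × ℝ)) 0 := h1.continuousAt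
      filter_upwards [hcy.preimage_mem_nhds (hVo.mem_nhds h0V)] with y hy
      exact (hzero y hy).symm
    exact h2.unique (h3.congr_of_eventuallyEq h4.symm)

theorem det_congruence (g11 g12 g22 o1 o2 h w1 w2 y1 y2 : ℝ)
    (e1 : g11 * w1 + g12 * w2 = 0) (e2 : g12 * w1 + g22 * w2 = 0) :
    (g11 * (g22 * h - o2 ^ 2) - g12 * (g12 * h - o1 * o2) + o1 * (g12 * o2 - g22 * o1))
      * (w1 * y2 - w2 * y1) ^ 2
    = -((g11 * y1 ^ 2 + 2 * g12 * y1 * y2 + g22 * y2 ^ 2) * (o1 * w1 + o2 * w2) ^ 2) := by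
  have hA : g11 * w1 ^ 2 + 2 * g12 * w1 * w2 + g22 * w2 ^ 2 = 0 := by
    linear_combination w1 * e1 + w2 * e2
  have hC : g11 * w1 * y1 + g12 * (w1 * y2 + w2 * y1) + g22 * w2 * y2 = 0 := by
    linear_combination y1 * e1 + y2 * e2
  linear_combination
    ((g11 * y1 ^ 2 + 2 * g12 * y1 * y2 + g22 * y2 ^ 2) * h - (o1 * y1 + o2 * y2) ^ 2) * hA
    + (- (g11 * w1 * y1 + g12 * (w1 * y2 + w2 * y1) + g22 * w2 * y2) * h
      + 2 * (o1 * w1 + o2 * w2) * (o1 * y1 + o2 * y2)) * hC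

theorem parabolic_core (g11 g12 g22 ω1 ω2 h : (ℝ × ℝ) → ℝ) (x₀ : ℝ × ℝ)
    (hg11 : ContDiff ℝ (⊤ : ℕ∞) g11) (hg12 : ContDiff ℝ (⊤ : ℕ∞) g12)
    (hg22 : ContDiff ℝ (⊤ : ℕ∞) g22) (hω1 : ContDiff ℝ (⊤ : ℕ∞) ω1)
    (hω2 : ContDiff ℝ (⊤ : ℕ∞) ω2) (hh : ContDiff ℝ (⊤ : ℕ∞) h)
    (W : ℝ × ℝ → ℝ × ℝ) (hW : ContDiff ℝ (⊤ : ℕ∞) W) (hW0 : W x₀ ≠ 0)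
    (U₂ : Set (ℝ × ℝ)) (hU₂ : IsOpen U₂) (hx₀ : x₀ ∈ U₂)
    (hker1 : ∀ x ∈ U₂, g11 x * (W x).1 + g12 x * (W x).2 = 0)
    (hker2 : ∀ x ∈ U₂, g12 x * (W x).1 + g22 x * (W x).2 = 0)
    (hΔ1 : ∀ x ∈ U₂, g11 x * (g22 x * h x - ω2 x ^ 2) - g12 x * (g12 x * h x - ω1 x * ω2 x)
        + ω1 x * (g12 x * ω2 x - g22 x * ω1 x) ≠ 0) :
    ∃ (a b c : (ℝ × ℝ) → ℝ) (V : Set (ℝ × ℝ)), IsOpen V ∧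
      ContDiffOn ℝ (⊤ : ℕ∞) a V ∧ ContDiffOn ℝ (⊤ : ℕ∞) b V ∧ ContDiffOn ℝ (⊤ : ℕ∞) c V ∧
      (∀ x ∈ V, a x ≠ 0) ∧
      LocEquivConic
        (fun x v => g11 x * v.1 ^ 2 + 2 * g12 x * v.1 * v.2 + g22 x * v.2 ^ 2
          + 2 * (ω1 x * v.1 + ω2 x * v.2) + h x)
        (fun x v => a x * v.2 ^ 2 - v.1 + b x * v.2 + c x)
        x₀ V := by
  obtain ⟨ψ, V₀, hV₀, h0V, hsm, hψ0, hflow, hT⟩ :=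
    flow_box W hW x₀ (-(W x₀).2, (W x₀).1)
  have hsplit : ∀ (A : (ℝ × ℝ) →L[ℝ] (ℝ × ℝ)) (v : ℝ × ℝ),
      A v = v.1 • A (1, 0) + v.2 • A (0, 1) := by
    intro A v
    rw [← map_smul, ← map_smul, ← map_add]
    simp
  have hpos : 0 < (W x₀).1 ^ 2 + (W x₀).2 ^ 2 := by
    by_contra hc
    push Not at hc
    apply hW0
    have h1 : (W x₀).1 = 0 := by nlinarith [sq_nonneg (W x₀).1, sq_nonneg (W x₀).2]
    have h2 : (W x₀).2 = 0 := by nlinarith [sq_nonneg (W x₀).1, sq_nonneg (W x₀).2]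
    exact Prod.ext h1 h2
  have hinj : Function.Injective (fderiv ℝ ψ (0, 0)).toLinearMap := by
    rw [← LinearMap.ker_eq_bot, LinearMap.ker_eq_bot']
    intro v hv
    change fderiv ℝ ψ (0, 0) v = 0 at hv
    rw [hsplit, hflow _ h0V, hT, hψ0] at hv
    have h1 := congrArg Prod.fst hv
    have h2 := congrArg Prod.snd hv
    simp at h1 h2
    have h3 : v.1 * ((W x₀).1 ^ 2 + (W x₀).2 ^ 2) = 0 := by
      linear_combination (W x₀).1 * h1 + (W x₀).2 * h2
    have h4 : v.2 * ((W x₀).1 ^ 2 + (W x₀).2 ^ 2) = 0 := by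
      linear_combination (W x₀).1 * h2 - (W x₀).2 * h1
    exact Prod.ext ((mul_eq_zero.1 h3).resolve_right hpos.ne')
      ((mul_eq_zero.1 h4).resolve_right hpos.ne')
  let e₀ : (ℝ × ℝ) ≃L[ℝ] (ℝ × ℝ) :=
    (LinearEquiv.ofInjectiveEndo _ hinj).toContinuousLinearEquiv
  have he₀ : HasFDerivAt ψ (e₀ : (ℝ × ℝ) →L[ℝ] (ℝ × ℝ)) (0, 0) := by
    have h1 : (e₀ : (ℝ × ℝ) →L[ℝ] (ℝ × ℝ)) = fderiv ℝ ψ (0, 0) := by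
      refine ContinuousLinearMap.ext fun v => rfl
    rw [h1]
    exact ((hsm.contDiffAt (hV₀.mem_nhds h0V)).differentiableAt (by simp)).hasFDerivAt
  obtain ⟨R, hR, h0R, hRV, hRe, hRs⟩ := smooth_local_inverse ψ V₀ hV₀ hsm (0, 0) h0V e₀ he₀
  set Y : ℝ × ℝ → ℝ × ℝ := fun p => fderiv ℝ ψ p (0, 1) with hY
  have hYs : ContDiffOn ℝ (⊤ : ℕ∞) Y V₀ :=
    (hsm.fderiv_of_isOpen hV₀ (by simp)).clm_apply contDiffOn_const
  set V : Set (ℝ × ℝ) := R.source ∩ ψ ⁻¹' U₂ with hV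
  have hVV₀ : V ⊆ V₀ := fun p hp => hRV hp.1
  have hVo : IsOpen V := (hsm.continuousOn.mono hRV).isOpen_inter_preimage R.open_source hU₂
  have hdet : ∀ p ∈ V, (W (ψ p)).1 * (Y p).2 - (W (ψ p)).2 * (Y p).1 ≠ 0 := by
    intro p hp hD
    obtain ⟨e, he⟩ := hRe p hp.1
    have hev : ∀ v : ℝ × ℝ, e v = v.1 • W (ψ p) + v.2 • Y p := by
      intro v
      have h1 : fderiv ℝ ψ p v = e v := by rw [he.fderiv]; rfl
      rw [← h1, hsplit, hflow p (hVV₀ hp)]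
    have hz : ∀ v : ℝ × ℝ, v.1 • W (ψ p) + v.2 • Y p = 0 → v = 0 := by
      intro v hv
      rw [← hev] at hv
      exact e.map_eq_zero_iff.1 hv
    have h1 := hz ((Y p).2, -(W (ψ p)).2) (by
      refine Prod.ext ?_ ?_ <;> simp <;> linarith)
    have h2 := hz ((Y p).1, -(W (ψ p)).1) (by
      refine Prod.ext ?_ ?_ <;> simp <;> linarith)
    simp only [Prod.mk_eq_zero, neg_eq_zero] at h1 h2
    have h3 := hz (1, 0) (by
      refine Prod.ext ?_ ?_ <;> simp [h1.2, h2.2])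
    simp at h3
  have hne : ∀ p ∈ V, (g11 (ψ p) * (Y p).1 ^ 2 + 2 * g12 (ψ p) * (Y p).1 * (Y p).2
        + g22 (ψ p) * (Y p).2 ^ 2 ≠ 0) ∧
      ω1 (ψ p) * (W (ψ p)).1 + ω2 (ψ p) * (W (ψ p)).2 ≠ 0 := by
    intro p hp
    have h1 := det_congruence _ _ _ (ω1 (ψ p)) (ω2 (ψ p)) (h (ψ p)) _ _ (Y p).1 (Y p).2
      (hker1 (ψ p) hp.2) (hker2 (ψ p) hp.2)
    have h2 := mul_ne_zero (hΔ1 (ψ p) hp.2) (pow_ne_zero 2 (hdet p hp))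
    rw [h1] at h2
    constructor
    · intro h3; apply h2; rw [h3]; ring
    · intro h3; apply h2; rw [h3]; ring
  have hψV : ContDiffOn ℝ (⊤ : ℕ∞) ψ V := hsm.mono hVV₀
  have hYV : ContDiffOn ℝ (⊤ : ℕ∞) Y V := hYs.mono hVV₀
  have hY1 : ContDiffOn ℝ (⊤ : ℕ∞) (fun p => (Y p).1) V := hYV.fst
  have hY2 : ContDiffOn ℝ (⊤ : ℕ∞) (fun p => (Y p).2) V := hYV.snd
  have hωW : ContDiff ℝ (⊤ : ℕ∞) (fun x => -2 * (ω1 x * (W x).1 + ω2 x * (W x).2)) :=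
    contDiff_const.mul ((hω1.mul hW.fst).add (hω2.mul hW.snd))
  have hden : ∀ p ∈ V, -2 * (ω1 (ψ p) * (W (ψ p)).1 + ω2 (ψ p) * (W (ψ p)).2) ≠ 0 :=
    fun p hp => mul_ne_zero (by norm_num) (hne p hp).2
  have hdenV : ContDiffOn ℝ (⊤ : ℕ∞)
      (fun p => -2 * (ω1 (ψ p) * (W (ψ p)).1 + ω2 (ψ p) * (W (ψ p)).2)) V :=
    hωW.comp_contDiffOn hψV
  have hUo : IsOpen (R.target ∩ R.symm ⁻¹' V) := R.isOpen_inter_preimage_symm hVo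
  have hψs : ∀ x ∈ R.target, ψ (R.symm x) = x := fun x hx => by
    rw [← hR]; exact R.right_inv hx
  refine ⟨fun p => (g11 (ψ p) * (Y p).1 ^ 2 + 2 * g12 (ψ p) * (Y p).1 * (Y p).2
        + g22 (ψ p) * (Y p).2 ^ 2) / (-2 * (ω1 (ψ p) * (W (ψ p)).1 + ω2 (ψ p) * (W (ψ p)).2)),
    fun p => (2 * (ω1 (ψ p) * (Y p).1 + ω2 (ψ p) * (Y p).2)) /
      (-2 * (ω1 (ψ p) * (W (ψ p)).1 + ω2 (ψ p) * (W (ψ p)).2)),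
    fun p => h (ψ p) / (-2 * (ω1 (ψ p) * (W (ψ p)).1 + ω2 (ψ p) * (W (ψ p)).2)),
    V, hVo, ?_, ?_, ?_, ?_, ?_⟩
  · refine ContDiffOn.div ?_ hdenV hden
    exact (((hg11.comp_contDiffOn hψV).mul (hY1.pow 2)).add
      (((contDiffOn_const.mul (hg12.comp_contDiffOn hψV)).mul hY1).mul hY2)).add
      ((hg22.comp_contDiffOn hψV).mul (hY2.pow 2))
  · refine ContDiffOn.div ?_ hdenV hden
    exact contDiffOn_const.mul (((hω1.comp_contDiffOn hψV).mul hY1).add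
      ((hω2.comp_contDiffOn hψV).mul hY2))
  · exact ContDiffOn.div (hh.comp_contDiffOn hψV) hdenV hden
  · intro p hp
    exact div_ne_zero (hne p hp).1 (hden p hp)
  · refine ⟨R.symm, fun x _ => 1 / (-2 * (ω1 x * (W x).1 + ω2 x * (W x).2)),
      R.target ∩ R.symm ⁻¹' V, hUo, ?_, hRs.mono inter_subset_left, ?_, ?_, ?_, ?_, ?_⟩
    · have h1 : R (0, 0) = x₀ := by rw [hR, hψ0]
      have h2 : R.symm x₀ = (0, 0) := by rw [← h1]; exact R.left_inv h0R
      refine ⟨h1 ▸ R.map_source h0R, ?_⟩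
      change R.symm x₀ ∈ V
      rw [h2]
      refine ⟨h0R, ?_⟩
      change ψ (0, 0) ∈ U₂
      rw [hψ0]; exact hx₀
    · rintro x ⟨hx, hxV⟩
      obtain ⟨e, he⟩ := hRe _ hxV.1
      have hs : HasFDerivAt R.symm (e.symm : (ℝ × ℝ) →L[ℝ] (ℝ × ℝ)) x :=
        R.hasFDerivAt_symm hx ((funext hR : (R : ℝ × ℝ → ℝ × ℝ) = ψ) ▸ he)
      rw [hs.fderiv]
      exact e.symm.bijective
    · exact fun x hx => hx.2
    · refine ContDiffOn.div contDiffOn_const ((hωW.comp contDiff_fst).contDiffOn) ?_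
      rintro ⟨x, v⟩ ⟨⟨hx, hxV⟩, -⟩
      have := hden _ hxV
      rwa [hψs x hx] at this
    · rintro x ⟨hx, hxV⟩ v
      have := hden _ hxV
      rw [hψs x hx] at this
      exact one_div_ne_zero this
    · rintro x ⟨hx, hxV⟩ v
      obtain ⟨e, he⟩ := hRe _ hxV.1
      have hs : HasFDerivAt R.symm (e.symm : (ℝ × ℝ) →L[ℝ] (ℝ × ℝ)) x :=
        R.hasFDerivAt_symm hx ((funext hR : (R : ℝ × ℝ → ℝ × ℝ) = ψ) ▸ he)
      have hd := hden _ hxV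
      have hfl := hflow _ (hVV₀ hxV)
      rw [hψs x hx] at hd hfl
      rw [hs.fderiv]
      set w : ℝ × ℝ := (e.symm : (ℝ × ℝ) →L[ℝ] (ℝ × ℝ)) v with hw
      have hv : v = w.1 • W x + w.2 • Y (R.symm x) := by
        have h1 : fderiv ℝ ψ (R.symm x) w = v := by
          rw [he.fderiv]
          exact e.apply_symm_apply v
        rw [← h1, hsplit, hfl]
      have hv1 : v.1 = w.1 * (W x).1 + w.2 * (Y (R.symm x)).1 := by
        conv_lhs => rw [hv]
        simp
      have hv2 : v.2 = w.1 * (W x).2 + w.2 * (Y (R.symm x)).2 := by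
        conv_lhs => rw [hv]
        simp
      have hxU : x ∈ U₂ := by
        have := hxV.2
        change ψ (R.symm x) ∈ U₂ at this
        rwa [hψs x hx] at this
      have k1 := hker1 x hxU
      have k2 := hker2 x hxU
      simp only [hψs x hx]
      rw [hv1, hv2]
      generalize (Y (R.symm x)).1 = y1 at *
      generalize (Y (R.symm x)).2 = y2 at *
      generalize (W x).1 = w1 at *
      generalize (W x).2 = w2 at *
      have hkey : g11 x * (w.1 * w1 + w.2 * y1) ^ 2
          + 2 * g12 x * (w.1 * w1 + w.2 * y1) * (w.1 * w2 + w.2 * y2)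
          + g22 x * (w.1 * w2 + w.2 * y2) ^ 2
          = w.2 ^ 2 * (g11 x * y1 ^ 2 + 2 * g12 x * y1 * y2 + g22 x * y2 ^ 2) := by
        linear_combination (w.1 ^ 2 * w1 + 2 * w.1 * w.2 * y1) * k1
          + (w.1 ^ 2 * w2 + 2 * w.1 * w.2 * y2) * k2
      rw [hkey]
      set d := -2 * (ω1 x * w1 + ω2 x * w2) with hdd
      have hfin : w.1 = w.1 * d / d := by field_simp
      rw [← sub_eq_zero]
      have : (g11 x * y1 ^ 2 + 2 * g12 x * y1 * y2 + g22 x * y2 ^ 2) / d * w.2 ^ 2 - w.1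
          + 2 * (ω1 x * y1 + ω2 x * y2) / d * w.2 + h x / d
          = ((g11 x * y1 ^ 2 + 2 * g12 x * y1 * y2 + g22 x * y2 ^ 2) * w.2 ^ 2 - w.1 * d
            + 2 * (ω1 x * y1 + ω2 x * y2) * w.2 + h x) / d := by
        field_simp
      rw [this, one_div, div_eq_mul_inv, hdd]
      ring

/-- a nonempty conic submanifold
`S_q(x,ẋ) = ẋᵀ g(x) ẋ + 2 ω(x) ẋ + h(x) = 0` with `Δ₁(x₀) ≠ 0` and `Δ₂ ≡ 0` on a
neighbourhood of `x₀` is, locally around `x₀`, equivalent to the parabolic form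
`{a·ẏ² − ż + b·ẏ + c = 0}` with `a, b, c` smooth and `a` nonvanishing. -/
theorem stmt_2 (g11 g12 g22 ω1 ω2 h : (ℝ × ℝ) → ℝ) (x₀ : ℝ × ℝ)
    (hg11 : ContDiff ℝ (⊤ : ℕ∞) g11) (hg12 : ContDiff ℝ (⊤ : ℕ∞) g12) (hg22 : ContDiff ℝ (⊤ : ℕ∞) g22)
    (hω1 : ContDiff ℝ (⊤ : ℕ∞) ω1) (hω2 : ContDiff ℝ (⊤ : ℕ∞) ω2) (hh : ContDiff ℝ (⊤ : ℕ∞) h)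
    -- the conic is nonempty near `x₀`
    (hne : ∃ U : Set (ℝ × ℝ), IsOpen U ∧ x₀ ∈ U ∧ ∀ x ∈ U, ∃ v : ℝ × ℝ,
      g11 x * v.1 ^ 2 + 2 * g12 x * v.1 * v.2 + g22 x * v.2 ^ 2
        + 2 * (ω1 x * v.1 + ω2 x * v.2) + h x = 0)
    -- `Δ₁(x₀) ≠ 0`
    (hΔ1 : g11 x₀ * (g22 x₀ * h x₀ - ω2 x₀ ^ 2) - g12 x₀ * (g12 x₀ * h x₀ - ω1 x₀ * ω2 x₀)
        + ω1 x₀ * (g12 x₀ * ω2 x₀ - g22 x₀ * ω1 x₀) ≠ 0)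
    -- `Δ₂ ≡ 0` on a neighbourhood of `x₀`
    (hΔ2 : ∃ U : Set (ℝ × ℝ), IsOpen U ∧ x₀ ∈ U ∧
      ∀ x ∈ U, g11 x * g22 x - g12 x ^ 2 = 0) :
    ∃ (a b c : (ℝ × ℝ) → ℝ) (V : Set (ℝ × ℝ)), IsOpen V ∧
      ContDiffOn ℝ (⊤ : ℕ∞) a V ∧ ContDiffOn ℝ (⊤ : ℕ∞) b V ∧ ContDiffOn ℝ (⊤ : ℕ∞) c V ∧
      (∀ x ∈ V, a x ≠ 0) ∧
      LocEquivConic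
        (fun x v => g11 x * v.1 ^ 2 + 2 * g12 x * v.1 * v.2 + g22 x * v.2 ^ 2
          + 2 * (ω1 x * v.1 + ω2 x * v.2) + h x)
        (fun x v => a x * v.2 ^ 2 - v.1 + b x * v.2 + c x)
        x₀ V := by
  obtain ⟨U, hU, hx, hU0⟩ := hΔ2
  have hcont : Continuous (fun x => g11 x * (g22 x * h x - ω2 x ^ 2)
      - g12 x * (g12 x * h x - ω1 x * ω2 x) + ω1 x * (g12 x * ω2 x - g22 x * ω1 x)) := by
    have := hg11.continuous
    have := hg12.continuous
    have := hg22.continuous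
    have := hω1.continuous
    have := hω2.continuous
    have := hh.continuous
    fun_prop
  have hO : IsOpen {x | g11 x * (g22 x * h x - ω2 x ^ 2)
      - g12 x * (g12 x * h x - ω1 x * ω2 x) + ω1 x * (g12 x * ω2 x - g22 x * ω1 x) ≠ 0} :=
    isOpen_ne_fun hcont continuous_const
  have hU0x := hU0 x₀ hx
  by_cases h11 : g11 x₀ = 0
  · have h12 : g12 x₀ = 0 := by
      rw [h11] at hU0x
      have : g12 x₀ ^ 2 = 0 := by linarith
      exact pow_eq_zero_iff (two_ne_zero) |>.1 this
    have h22 : g22 x₀ ≠ 0 := by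
      intro h22
      apply hΔ1
      rw [h11, h12, h22]; ring
    refine parabolic_core g11 g12 g22 ω1 ω2 h x₀ hg11 hg12 hg22 hω1 hω2 hh
      (fun x => (-g22 x, g12 x)) (hg22.neg.prodMk hg12) ?_ _ (hU.inter hO) ⟨hx, hΔ1⟩ ?_ ?_
      (fun x hx => hx.2)
    · intro hc
      apply h22
      simpa using congrArg Prod.fst hc
    · intro x hx
      have := hU0 x hx.1
      simp only
      linarith
    · intro x hx
      simp only
      ring
  · refine parabolic_core g11 g12 g22 ω1 ω2 h x₀ hg11 hg12 hg22 hω1 hω2 hh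
      (fun x => (-g12 x, g11 x)) (hg12.neg.prodMk hg11) ?_ _ (hU.inter hO) ⟨hx, hΔ1⟩ ?_ ?_
      (fun x hx => hx.2)
    · intro hc
      apply h11
      simpa using congrArg Prod.snd hc
    · intro x hx
      simp only
      ring
    · intro x hx
      have := hU0 x hx.1
      simp only
      linarith
end
end

section
/- Let τ ∈ ℝ, let I ⊆ ℝ be an open interval containing w₀, and let f: I → ℝ be a smooth function satisfying f'''(w) = τ·f'(w) for all w ∈ I. Then for all w ∈ I, f(w) = f''(w₀)·Σ_{k≥0} (w−w₀)^{2k+2} τᵏ/(2k+2)! + f'(w₀)·Σ_{k≥0} (w−w₀)^{2k+1} τᵏ/(2k+1)! + f(w₀). -/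
noncomputable def serS (τ : ℝ) (j : ℕ) (x : ℝ) : ℝ :=
  ∑' k : ℕ, x ^ (2 * k + j) * τ ^ k / (Nat.factorial (2 * k + j) : ℝ)

lemma ser_bound (τ : ℝ) (j k : ℕ) (x R : ℝ) (hx : |x| ≤ R) :
    ‖x ^ (2 * k + j) * τ ^ k / (Nat.factorial (2 * k + j) : ℝ)‖
      ≤ R ^ j * ((R ^ 2 * |τ|) ^ k / (Nat.factorial k : ℝ)) := by
  have hR : 0 ≤ R := (abs_nonneg x).trans hx
  have e : R ^ j * ((R ^ 2 * |τ|) ^ k / (Nat.factorial k : ℝ))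
      = R ^ (2 * k + j) * |τ| ^ k / (Nat.factorial k : ℝ) := by
    rw [mul_pow, ← pow_mul, pow_add]; ring
  rw [e, norm_div, norm_mul, norm_pow, norm_pow, Real.norm_eq_abs, Real.norm_eq_abs,
    Real.norm_natCast]
  have h1 : (Nat.factorial k : ℝ) ≤ (Nat.factorial (2 * k + j) : ℝ) := by
    exact_mod_cast Nat.factorial_le (by omega)
  have h2 : (0 : ℝ) < (Nat.factorial k : ℝ) := by exact_mod_cast Nat.factorial_pos k
  gcongr

lemma ser_bound_summable (τ : ℝ) (j : ℕ) (R : ℝ) :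
    Summable fun k : ℕ => R ^ j * ((R ^ 2 * |τ|) ^ k / (Nat.factorial k : ℝ)) :=
  (Real.summable_pow_div_factorial _).mul_left _

lemma ser_summable (τ : ℝ) (j : ℕ) (x : ℝ) :
    Summable fun k : ℕ => x ^ (2 * k + j) * τ ^ k / (Nat.factorial (2 * k + j) : ℝ) :=
  Summable.of_norm_bounded (ser_bound_summable τ j |x|)
    (fun k => ser_bound τ j k x |x| le_rfl)

lemma serS_hasDerivAt (τ : ℝ) (j : ℕ) (x : ℝ) :
    HasDerivAt (serS τ (j + 1)) (serS τ j x) x := by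
  have hx : x ∈ Metric.ball (0 : ℝ) (|x| + 1) := by simp
  refine hasDerivAt_tsum_of_isPreconnected
    (g := fun (k : ℕ) (y : ℝ) => y ^ (2 * k + (j + 1)) * τ ^ k /
      (Nat.factorial (2 * k + (j + 1)) : ℝ))
    (g' := fun (k : ℕ) (y : ℝ) => y ^ (2 * k + j) * τ ^ k / (Nat.factorial (2 * k + j) : ℝ))
    (ser_bound_summable τ j (|x| + 1)) Metric.isOpen_ball
    (convex_ball (0 : ℝ) (|x| + 1)).isPreconnected ?_ ?_ hx (ser_summable τ (j + 1) x) hx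
  · intro k y _
    have h := ((hasDerivAt_pow (2 * k + j + 1) y).mul_const (τ ^ k)).div_const
      (Nat.factorial (2 * k + j + 1) : ℝ)
    refine h.congr_deriv ?_
    rw [Nat.factorial_succ]
    have h2 : (Nat.factorial (2 * k + j) : ℝ) ≠ 0 := by
      exact_mod_cast Nat.factorial_ne_zero _
    have h3 : ((2 * k + j + 1 : ℕ) : ℝ) ≠ 0 := Nat.cast_ne_zero.2 (by omega)
    rw [Nat.cast_mul, Nat.add_sub_cancel]
    field_simp
  · intro k y hy
    refine ser_bound τ j k y _ ?_
    have := mem_ball_zero_iff.1 hy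
    exact this.le

lemma serS_zero (τ x : ℝ) : serS τ 0 x = 1 + τ * serS τ 2 x := by
  unfold serS
  rw [(ser_summable τ 0 x).tsum_eq_zero_add, ← tsum_mul_left]
  congr 1
  · simp
  · refine tsum_congr fun k => ?_
    rw [show 2 * (k + 1) + 0 = 2 * k + 2 by ring]
    ring

lemma serS_at_zero (τ : ℝ) (j : ℕ) : serS τ (j + 1) 0 = 0 := by
  unfold serS
  simp

lemma serS_zero_hasDerivAt (τ x : ℝ) : HasDerivAt (serS τ 0) (τ * serS τ 1 x) x := by
  have : serS τ 0 = fun y => 1 + τ * serS τ 2 y := funext (serS_zero τ)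
  rw [this]
  exact ((serS_hasDerivAt τ 1 x).const_mul τ).const_add 1

lemma const_of_deriv_zero (a b w₀ : ℝ) (g : ℝ → ℝ) (hw₀ : w₀ ∈ Set.Ioo a b)
    (h : ∀ w ∈ Set.Ioo a b, HasDerivAt g 0 w) (w : ℝ) (hw : w ∈ Set.Ioo a b) : g w = g w₀ :=
  isOpen_Ioo.is_const_of_deriv_eq_zero isPreconnected_Ioo
    (fun y hy => (h y hy).differentiableAt.differentiableWithinAt)
    (fun y hy => (h y hy).deriv) hw hw₀

/-- If `f` is smooth on an open interval `I = (a,b)` containing `w₀` and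
satisfies `f''' = τ·f'` on `I`, then for all `w ∈ I`,
`f(w) = f''(w₀)·Σ_{k≥0} (w−w₀)^(2k+2) τᵏ/(2k+2)! + f'(w₀)·Σ_{k≥0} (w−w₀)^(2k+1) τᵏ/(2k+1)! + f(w₀)`. -/
theorem stmt_4 (τ : ℝ) (a b w₀ : ℝ) (f : ℝ → ℝ)
    (hw₀ : w₀ ∈ Set.Ioo a b)
    (hf : ContDiffOn ℝ (⊤ : ℕ∞) f (Set.Ioo a b))
    (hode : ∀ w ∈ Set.Ioo a b, deriv (deriv (deriv f)) w = τ * deriv f w) :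
    ∀ w ∈ Set.Ioo a b,
      f w = deriv (deriv f) w₀ *
              (∑' k : ℕ, (w - w₀) ^ (2 * k + 2) * τ ^ k / (Nat.factorial (2 * k + 2) : ℝ))
          + deriv f w₀ *
              (∑' k : ℕ, (w - w₀) ^ (2 * k + 1) * τ ^ k / (Nat.factorial (2 * k + 1) : ℝ))
          + f w₀ := by
  have hsm : ∀ w ∈ Set.Ioo a b, ContDiffAt ℝ (⊤ : ℕ∞) f w := fun w hw =>
    hf.contDiffAt (isOpen_Ioo.mem_nhds hw)
  have e1 : ContDiffOn ℝ (⊤ : ℕ∞) (deriv f) (Set.Ioo a b) :=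
    ((contDiffOn_infty_iff_deriv_of_isOpen isOpen_Ioo).1 hf).2
  have e2 : ContDiffOn ℝ (⊤ : ℕ∞) (deriv (deriv f)) (Set.Ioo a b) :=
    ((contDiffOn_infty_iff_deriv_of_isOpen isOpen_Ioo).1 e1).2
  have key : ∀ g : ℝ → ℝ, ContDiffOn ℝ (⊤ : ℕ∞) g (Set.Ioo a b) →
      ∀ w ∈ Set.Ioo a b, HasDerivAt g (deriv g w) w := fun g hg w hw =>
    ((hg.contDiffAt (isOpen_Ioo.mem_nhds hw)).differentiableAt (by simp)).hasDerivAt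
  have d0 := key f hf
  have d1 := key _ e1
  have d2 : ∀ w ∈ Set.Ioo a b, HasDerivAt (deriv (deriv f)) (τ * deriv f w) w := fun w hw => by
    rw [← hode w hw]; exact key _ e2 w hw
  have sD : ∀ (j : ℕ) (w : ℝ),
      HasDerivAt (fun w => serS τ (j + 1) (w - w₀)) (serS τ j (w - w₀)) w := fun j w =>
    (serS_hasDerivAt τ j (w - w₀)).comp_sub_const w w₀
  have sD0 : ∀ w : ℝ,
      HasDerivAt (fun w => serS τ 0 (w - w₀)) (τ * serS τ 1 (w - w₀)) w := fun w =>
    (serS_zero_hasDerivAt τ (w - w₀)).comp_sub_const w w₀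
  have z0 : serS τ 0 0 = 1 := by rw [serS_zero, serS_at_zero]; simp
  have z1 : serS τ 1 0 = 0 := serS_at_zero τ 0
  have z2 : serS τ 2 0 = 0 := serS_at_zero τ 1
  have c1 := const_of_deriv_zero a b w₀
    (fun w => serS τ 0 (w - w₀) * deriv f w - serS τ 1 (w - w₀) * deriv (deriv f) w) hw₀
    (fun w hw => (((sD0 w).mul (d1 w hw)).sub ((sD 0 w).mul (d2 w hw))).congr_deriv (by ring))
  have c2 := const_of_deriv_zero a b w₀
    (fun w => serS τ 0 (w - w₀) * deriv (deriv f) w - τ * (serS τ 1 (w - w₀) * deriv f w)) hw₀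
    (fun w hw => (((sD0 w).mul (d2 w hw)).sub
      (((sD 0 w).mul (d1 w hw)).const_mul τ)).congr_deriv (by ring))
  have c3 := const_of_deriv_zero a b w₀
    (fun w => serS τ 0 (w - w₀) * serS τ 0 (w - w₀)
      - τ * (serS τ 1 (w - w₀) * serS τ 1 (w - w₀))) hw₀
    (fun w hw => (((sD0 w).mul (sD0 w)).sub
      (((sD 0 w).mul (sD 0 w)).const_mul τ)).congr_deriv (by ring))
  simp only [sub_self, z0, z1] at c1 c2 c3
  have hu : ∀ w ∈ Set.Ioo a b, deriv f w =
      deriv (deriv f) w₀ * serS τ 1 (w - w₀) + deriv f w₀ * serS τ 0 (w - w₀) := by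
    intro w hw
    linear_combination serS τ 0 (w - w₀) * c1 w hw + serS τ 1 (w - w₀) * c2 w hw
      - deriv f w * c3 w hw
  have c4 := const_of_deriv_zero a b w₀
    (fun w => f w - (deriv (deriv f) w₀ * serS τ 2 (w - w₀) + deriv f w₀ * serS τ 1 (w - w₀)))
    hw₀
    (fun w hw => ((d0 w hw).sub (((sD 1 w).const_mul _).add ((sD 0 w).const_mul _))).congr_deriv
      (by rw [hu w hw]; ring))
  simp only [sub_self, z1, z2] at c4
  intro w hw
  have h := c4 w hw
  change f w = deriv (deriv f) w₀ * serS τ 2 (w - w₀) + deriv f w₀ * serS τ 1 (w - w₀) + f w₀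
  linear_combination h
end
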